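/- arXiv:2503.09284 — 2 statements merged into one kernel-verified Lean document; each statement's English description precedes it below -/
import Mathlib

section
/- Let (Z_n, ρ_n), n ≥ 1, be a sequence of antipodal spaces that AI-converges to an antipodal space (Z, ρ_0). Then the pointed Moebius spaces (𝓜(Z_n, ρ_n), ρ_n) converge to (𝓜(Z, ρ_0), ρ_0) in the pointed Gromov–Hausdorff sense. -/
open Filter Topology Metric
open scoped ENNReal

universe u v

/-- A semi-metric (separating function) on a compact metrizable space: continuous, symmetric,
nonnegative, and vanishing exactly on the diagonal. -/
def IsSemiMetric {Z : Type*} [TopologicalSpace Z] (ρ : Z → Z → ℝ) : Prop :=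
  Continuous (Function.uncurry ρ) ∧ (∀ ξ η, ρ ξ η = ρ η ξ) ∧
    (∀ ξ η, 0 ≤ ρ ξ η) ∧ ∀ ξ η, ρ ξ η = 0 ↔ ξ = η

/-- An antipodal function: a semi-metric of diameter at most one such that every point has an
antipode at distance one. -/
def IsAntipodalFn {Z : Type*} [TopologicalSpace Z] (ρ : Z → Z → ℝ) : Prop :=
  IsSemiMetric ρ ∧ (∀ ξ η, ρ ξ η ≤ 1) ∧ ∀ ξ, ∃ η, ρ ξ η = 1

/-- An `ε`-isometry between semi-metric spaces: distortion less than `ε`, and the image is an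
`ε`-net. -/
def IsEpsIsometry {Z₁ : Type*} {Z₂ : Type*} (ρ₁ : Z₁ → Z₁ → ℝ) (ρ₂ : Z₂ → Z₂ → ℝ)
    (ε : ℝ) (f : Z₁ → Z₂) : Prop :=
  (∀ ξ η : Z₁, |ρ₂ (f ξ) (f η) - ρ₁ ξ η| < ε) ∧ ∀ ζ : Z₂, ∃ ξ : Z₁, ρ₂ (f ξ) ζ < ε

/-- AI-convergence of a sequence of semi-metric spaces `(Z n, ρ n)` to `(W, ρ₀)`: there are
`ε n`-isometries `(Z n, ρ n) → (W, ρ₀)` with `ε n → 0+`. -/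
def AIConverges {Z : ℕ → Type u} (ρ : ∀ n, Z n → Z n → ℝ) {W : Type v} (ρ₀ : W → W → ℝ) : Prop :=
  ∃ ε : ℕ → ℝ, (∀ n, 0 < ε n) ∧ Tendsto ε atTop (𝓝 0) ∧
    ∀ n, ∃ f : Z n → W, IsEpsIsometry (ρ n) ρ₀ (ε n) f

/-- Rescaling a semi-metric `ρ₀` by a function `τ`:
`(scaleFn ρ₀ τ) ξ η = e^{τ ξ/2} e^{τ η/2} ρ₀ ξ η`, i.e. the semi-metric Moebius equivalent to
`ρ₀` with `log` derivative `τ`. -/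
noncomputable def scaleFn {Z : Type*} (ρ₀ : Z → Z → ℝ) (τ : Z → ℝ) : Z → Z → ℝ :=
  fun ξ η => Real.exp (τ ξ / 2) * Real.exp (τ η / 2) * ρ₀ ξ η

/-- The Moebius space `𝓜(Z, ρ₀)`: all antipodal functions Moebius equivalent to `ρ₀`,
parametrized by their `log` derivatives `τ ∈ C(Z, ℝ)`; for `Z` compact the sup-metric on
`C(Z, ℝ)` induces exactly the metric `d_𝓜(ρ₁, ρ₂) = ‖log (dρ₂/dρ₁)‖_∞`. -/
def MoebiusSpace {Z : Type*} [TopologicalSpace Z] (ρ₀ : Z → Z → ℝ) : Type _ :=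
  {τ : C(Z, ℝ) // IsAntipodalFn (scaleFn ρ₀ τ)}

noncomputable instance {Z : Type*} [TopologicalSpace Z] [CompactSpace Z] (ρ₀ : Z → Z → ℝ) :
    MetricSpace (MoebiusSpace ρ₀) :=
  inferInstanceAs (MetricSpace {τ : C(Z, ℝ) // IsAntipodalFn (scaleFn ρ₀ τ)})

/-- The base point `ρ₀ ∈ 𝓜(Z, ρ₀)`, corresponding to `τ = 0`. -/
noncomputable def MoebiusBase {Z : Type*} [TopologicalSpace Z] (ρ₀ : Z → Z → ℝ)
    (h : IsAntipodalFn ρ₀) : MoebiusSpace ρ₀ :=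
  ⟨0, by
    have h0 : scaleFn ρ₀ ((0 : C(Z, ℝ)) : Z → ℝ) = ρ₀ := by
      funext ξ η
      simp [scaleFn]
    rw [h0]
    exact h⟩

/-- Pointed Gromov–Hausdorff convergence of pointed metric spaces `(X n, p n) → (Y, q)`:
for every `R > 0` and `ε > 0`, for all sufficiently large `n` there is a map between the closed
balls of radius `R` around the base points, sending base point to base point, with distortion
less than `ε` and whose image is an `ε`-net. -/
def PointedGHConverges (X : ℕ → Type u) [∀ n, MetricSpace (X n)] (p : ∀ n, X n)
    (Y : Type v) [MetricSpace Y] (q : Y) : Prop :=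
  ∀ (R : ℝ) (hR : 0 < R) (ε : ℝ) (_ : 0 < ε), ∃ N : ℕ, ∀ n, N ≤ n →
    ∃ f : Metric.closedBall (p n) R → Metric.closedBall q R,
      ((f ⟨p n, Metric.mem_closedBall_self hR.le⟩ : Y) = q) ∧
      (∀ a b : Metric.closedBall (p n) R,
        |dist (f a : Y) (f b : Y) - dist (a : X n) (b : X n)| < ε) ∧
      ∀ z : Metric.closedBall q R, ∃ a : Metric.closedBall (p n) R, dist (f a : Y) (z : Y) < ε

/-- Uniform control of `ρ x ·` by `ρ x y` on a compact semi-metric space. -/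
theorem IsSemiMetric.exists_modulus {Z : Type*} [TopologicalSpace Z] [CompactSpace Z]
    {ρ : Z → Z → ℝ} (hρ : IsSemiMetric ρ) {κ : ℝ} (hκ : 0 < κ) :
    ∃ η > 0, ∀ x y, ρ x y < η → ∀ z, |ρ x z - ρ y z| ≤ κ := by
  obtain ⟨hc, -, hnonneg, hzero⟩ := hρ
  have hcont : ∀ {g h : Z × Z × Z → Z}, Continuous g → Continuous h →
      Continuous fun p => ρ (g p) (h p) := fun hg hh => hc.comp (hg.prodMk hh)
  set K : Set (Z × Z × Z) := {p | κ ≤ |ρ p.1 p.2.2 - ρ p.2.1 p.2.2|}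
  have hK : IsCompact K := by
    refine IsClosed.isCompact (isClosed_le continuous_const ?_)
    exact ((hcont (by fun_prop) (by fun_prop)).sub (hcont (by fun_prop) (by fun_prop))).abs
  rcases K.eq_empty_or_nonempty with he | hne
  · refine ⟨1, one_pos, fun x y _ z => ?_⟩
    by_contra! h
    have : (x, y, z) ∈ K := h.le
    simp [he] at this
  · obtain ⟨p, hpK, hp⟩ := hK.exists_isMinOn hne
      (f := fun p => ρ p.1 p.2.1) (hcont (by fun_prop) (by fun_prop)).continuousOn
    refine ⟨ρ p.1 p.2.1, lt_of_le_of_ne (hnonneg _ _) fun h => ?_, fun x y hxy z => ?_⟩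
    · have hpK' : κ ≤ |ρ p.1 p.2.2 - ρ p.2.1 p.2.2| := hpK
      rw [(hzero _ _).1 h.symm, sub_self, abs_zero] at hpK'
      linarith
    · by_contra! h
      have hmem : (x, y, z) ∈ K := h.le
      exact absurd (hp hmem) (not_le.2 hxy)

/-- Any subextremal function is dominated by an extremal one, where the constraint is
`τ x + τ y ≤ L x y` off the diagonal. -/
theorem exists_extremal_ge {Z : Type*} (L : Z → Z → ℝ) (hL : ∀ x y, L x y = L y x)
    (hne : ∀ x : Z, ∃ y, x ≠ y) (σ : Z → ℝ) (hσ : ∀ x y, x ≠ y → σ x + σ y ≤ L x y) :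
    ∃ τ : Z → ℝ, σ ≤ τ ∧ (∀ x y, x ≠ y → τ x + τ y ≤ L x y) ∧
      ∀ x, ∀ ε > 0, ∃ y, x ≠ y ∧ L x y - ε < τ x + τ y := by
  classical
  let S : Set (Z → ℝ) := {τ | σ ≤ τ ∧ ∀ x y, x ≠ y → τ x + τ y ≤ L x y}
  obtain ⟨τ, hστ, hmax⟩ := zorn_le_nonempty₀ S (fun c hcS hc t₀ ht₀ => by
    have hbdd : ∀ x, BddAbove (Set.range fun t : c => t.1 x) := fun x => by
      obtain ⟨y, hy⟩ := hne x
      refine ⟨L x y - σ y, ?_⟩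
      rintro _ ⟨t, rfl⟩
      have h1 := (hcS t.2).2 x y hy
      have h2 := (hcS t.2).1 y
      show t.1 x ≤ _
      linarith
    have : Nonempty c := ⟨⟨t₀, ht₀⟩⟩
    refine ⟨fun x => ⨆ t : c, t.1 x, ⟨fun x => ?_, fun x y hxy => ?_⟩, fun t ht x => ?_⟩
    · exact ((hcS ht₀).1 x).trans (le_ciSup (hbdd x) ⟨t₀, ht₀⟩)
    · suffices (⨆ t : c, t.1 x) ≤ L x y - ⨆ t : c, t.1 y by linarith
      refine ciSup_le fun t => ?_
      suffices (⨆ t : c, t.1 y) ≤ L x y - t.1 x by linarith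
      refine ciSup_le fun s => ?_
      rcases hc.total t.2 s.2 with h | h
      · have h1 := (hcS s.2).2 x y hxy
        have h2 := h x
        linarith
      · have h1 := (hcS t.2).2 x y hxy
        have h2 := h y
        linarith
    · exact le_ciSup (hbdd x) ⟨t, ht⟩) σ ⟨le_rfl, hσ⟩
  refine ⟨τ, hστ, hmax.1.2, fun x ε hε => ?_⟩
  by_contra! h
  have hle : τ ≤ Function.update τ x (τ x + ε) := by
    intro y
    by_cases hy : y = x
    · subst hy; simp [hε.le]
    · simp [hy]
  have hmem : Function.update τ x (τ x + ε) ∈ S := by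
    refine ⟨hστ.trans hle, fun u v huv => ?_⟩
    by_cases hu : u = x
    · subst hu
      have := h v huv
      simp only [Function.update_self, Function.update_of_ne huv.symm]
      linarith
    · by_cases hv : v = x
      · subst hv
        have := h u huv.symm
        rw [hL v u] at this
        simp only [Function.update_self, Function.update_of_ne hu]
        linarith
      · simp only [Function.update_of_ne hu, Function.update_of_ne hv]
        exact hmax.1.2 u v huv
  have := hmax.2 hmem hle x
  simp only [Function.update_self] at this
  linarith

/-- Functions that are extremal for `ρ` and bounded by `R` are controlled by the variation of `ρ`:
one-sided estimate. -/
theorem le_add_of_variation_le {Z : Type*} {ρ : Z → Z → ℝ} {τ : Z → ℝ} {R κ δ : ℝ}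
    (hκ : Real.exp R * κ ≤ 1 - Real.exp (-δ / 2)) (hR : ∀ x, |τ x| ≤ R)
    (hsub : ∀ x y, scaleFn ρ τ x y ≤ 1)
    (hattain : ∀ x, ∀ ε > 0, ∃ y, 1 - ε < scaleFn ρ τ x y) {x y : Z}
    (hxy : ∀ z, |ρ x z - ρ y z| ≤ κ) : τ y ≤ τ x + δ := by
  have key : Real.exp (-δ / 2) ≤ Real.exp ((τ x - τ y) / 2) := by
    refine le_of_forall_pos_sub_le fun ε hε => ?_
    obtain ⟨z, hz⟩ := hattain x ε hε
    have h1 := hsub y z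
    unfold scaleFn at hz h1
    have hE : Real.exp (τ x / 2) * Real.exp (τ z / 2) ≤ Real.exp R := by
      rw [← Real.exp_add]
      exact Real.exp_le_exp.2 (by have := (abs_le.1 (hR x)).2; have := (abs_le.1 (hR z)).2; linarith)
    have hpos : 0 < Real.exp (τ x / 2) * Real.exp (τ z / 2) := by positivity
    have h2 := (abs_le.1 (hxy z)).2
    have hκ0 : 0 ≤ κ := (abs_nonneg _).trans (hxy z)
    have e1 : Real.exp ((τ x - τ y) / 2) * (Real.exp (τ y / 2) * Real.exp (τ z / 2) * ρ y z)
        = Real.exp (τ x / 2) * Real.exp (τ z / 2) * ρ y z := by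
      rw [← mul_assoc, ← mul_assoc, ← Real.exp_add]
      ring_nf
    have h3 := mul_le_mul_of_nonneg_left h1 (Real.exp_pos ((τ x - τ y) / 2)).le
    rw [e1, mul_one] at h3
    have h4 := mul_le_mul_of_nonneg_left h2 hpos.le
    have h5 := mul_le_mul_of_nonneg_right hE hκ0
    rw [mul_sub] at h4
    linarith
  have := Real.exp_le_exp.1 key
  linarith

/-- Two-sided version of `le_add_of_variation_le`. -/
theorem abs_sub_le_of_variation_le {Z : Type*} {ρ : Z → Z → ℝ} {τ : Z → ℝ} {R κ δ : ℝ}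
    (hκ : Real.exp R * κ ≤ 1 - Real.exp (-δ / 2)) (hR : ∀ x, |τ x| ≤ R)
    (hsub : ∀ x y, scaleFn ρ τ x y ≤ 1)
    (hattain : ∀ x, ∀ ε > 0, ∃ y, 1 - ε < scaleFn ρ τ x y) {x y : Z}
    (hxy : ∀ z, |ρ x z - ρ y z| ≤ κ) : |τ x - τ y| ≤ δ := by
  have h1 := le_add_of_variation_le hκ hR hsub hattain hxy
  have h2 := le_add_of_variation_le hκ hR hsub hattain
    (x := y) (y := x) (fun z => by rw [abs_sub_comm]; exact hxy z)
  exact abs_le.2 ⟨by linarith, by linarith⟩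

/-- A bounded extremal function is continuous and defines an antipodal function. -/
theorem exists_moebius_of_extremal {Z : Type*} [TopologicalSpace Z] [CompactSpace Z]
    {ρ : Z → Z → ℝ} (hρ : IsAntipodalFn ρ) {τ : Z → ℝ} {R : ℝ} (hR : ∀ x, |τ x| ≤ R)
    (hsub : ∀ x y, scaleFn ρ τ x y ≤ 1)
    (hattain : ∀ x, ∀ ε > 0, ∃ y, 1 - ε < scaleFn ρ τ x y) :
    ∃ a : MoebiusSpace ρ, ∀ x, a.1 x = τ x := by
  obtain ⟨hsemi, -, -⟩ := hρ
  have hmod := @IsSemiMetric.exists_modulus _ _ _ _ hsemi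
  obtain ⟨hc, hsymm, hnonneg, hzero⟩ := hsemi
  have hτ : Continuous τ := by
    refine continuous_iff_continuousAt.2 fun x => Metric.continuousAt_iff'.2 fun δ hδ => ?_
    have hpos : 0 < 1 - Real.exp (-(δ / 2) / 2) := by
      rw [sub_pos, Real.exp_lt_one_iff]; linarith
    obtain ⟨η, hη, h⟩ := hmod (div_pos hpos (Real.exp_pos R))
    have hnear : ∀ᶠ y in 𝓝 x, ρ x y < η := by
      have hcx : Continuous fun y => ρ x y := hc.comp (by fun_prop : Continuous fun y => (x, y))
      exact hcx.continuousAt.eventually_lt_const (((hzero x x).2 rfl).trans_lt hη)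
    filter_upwards [hnear] with y hy
    have := abs_sub_le_of_variation_le (δ := δ / 2)
      (by rw [mul_div_cancel₀ _ (Real.exp_pos R).ne']) hR hsub hattain (h x y hy)
    rw [Real.dist_eq, abs_sub_comm]
    linarith
  have hcs : Continuous (Function.uncurry (scaleFn ρ τ)) := by
    have h1 : Continuous fun p : Z × Z => Real.exp (τ p.1 / 2) * Real.exp (τ p.2 / 2) := by
      fun_prop
    exact h1.mul hc
  refine ⟨⟨⟨τ, hτ⟩, ⟨hcs, fun x y => ?_, fun x y => ?_, fun x y => ?_⟩, hsub, fun x => ?_⟩,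
    fun x => rfl⟩
  · simp only [scaleFn, hsymm x y]; ring
  · exact mul_nonneg (by positivity) (hnonneg x y)
  · rw [← hzero x y]
    simp [scaleFn, Real.exp_ne_zero]
  · have hcx : Continuous fun y => scaleFn ρ τ x y :=
      hcs.comp (by fun_prop : Continuous fun y => (x, y))
    obtain ⟨y, -, hy⟩ := isCompact_univ.exists_isMaxOn (⟨x, trivial⟩ : (Set.univ : Set Z).Nonempty)
      hcx.continuousOn
    refine ⟨y, le_antisymm (hsub x y) (le_of_forall_pos_sub_le fun ε hε => ?_)⟩
    obtain ⟨z, hz⟩ := hattain x ε hε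
    exact hz.le.trans (hy (Set.mem_univ z))

/-- Additive form of `scaleFn` at points where `ρ` is positive. -/
theorem scaleFn_eq_exp {Z : Type*} {ρ : Z → Z → ℝ} {τ : Z → ℝ} {x y : Z} (h : 0 < ρ x y) :
    scaleFn ρ τ x y = Real.exp ((τ x + τ y) / 2 + Real.log (ρ x y)) := by
  rw [scaleFn, Real.exp_add, Real.exp_log h, ← Real.exp_add, add_div]

/-- An approximately extremal function bounded by `R` is close to an element of the Moebius space
in the ball of radius `R`. -/
theorem exists_moebius_close_of_approx {Z : Type*} [TopologicalSpace Z] [CompactSpace Z]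
    {ρ : Z → Z → ℝ} (hρ : IsAntipodalFn ρ) {σ : Z → ℝ} {R δ : ℝ} (hδ : 0 < δ)
    (hR : ∀ x, |σ x| ≤ R) (hsub : ∀ x y, scaleFn ρ σ x y ≤ Real.exp δ)
    (hattain : ∀ x, ∃ y, Real.exp (-δ) ≤ scaleFn ρ σ x y) :
    ∃ a : MoebiusSpace ρ, (∀ x, |a.1 x| ≤ R) ∧ ∀ x, |a.1 x - σ x| ≤ 3 * δ := by
  obtain ⟨⟨-, hsymm, hnonneg, hzero⟩, hle1, hanti⟩ := id hρ
  have hpos : ∀ x y, x ≠ y → 0 < ρ x y := fun x y hxy =>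
    lt_of_le_of_ne (hnonneg x y) fun h => hxy ((hzero x y).1 h.symm)
  have hne_of_pos : ∀ x y, 0 < ρ x y → x ≠ y := fun x y h hxy =>
    h.ne' ((hzero x y).2 hxy)
  have hlog : ∀ x y, Real.log (ρ x y) ≤ 0 := fun x y =>
    Real.log_nonpos (hnonneg x y) (hle1 x y)
  have hantine : ∀ x, ∃ y, x ≠ y ∧ Real.log (ρ x y) = 0 := fun x => by
    obtain ⟨y, hy⟩ := hanti x
    exact ⟨y, hne_of_pos x y (by rw [hy]; exact one_pos), by rw [hy, Real.log_one]⟩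
  obtain ⟨τ, hστ, hτ, hext⟩ := exists_extremal_ge (fun x y => -2 * Real.log (ρ x y))
    (fun x y => by simp only [hsymm x y]) (fun x => (hantine x).imp fun _ h => h.1)
    (fun x => max (σ x - δ) (-R)) (fun x y hxy => by
      have h1 := hsub x y
      rw [scaleFn_eq_exp (hpos x y hxy), Real.exp_le_exp] at h1
      have h2 := hlog x y
      have h3 := abs_le.1 (hR x)
      have h4 := abs_le.1 (hR y)
      show max (σ x - δ) (-R) + max (σ y - δ) (-R) ≤ -2 * Real.log (ρ x y)
      rcases max_cases (σ x - δ) (-R) with ⟨e, _⟩ | ⟨e, _⟩ <;>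
      rcases max_cases (σ y - δ) (-R) with ⟨e', _⟩ | ⟨e', _⟩ <;> rw [e, e'] <;> linarith)
  have hτlow : ∀ x, -R ≤ τ x := fun x => (le_max_right _ _).trans (hστ x)
  have hτσ : ∀ x, σ x - δ ≤ τ x := fun x => (le_max_left _ _).trans (hστ x)
  have hτR : ∀ x, |τ x| ≤ R := fun x => by
    obtain ⟨y, hxy, hy⟩ := hantine x
    have h1 := hτ x y hxy
    have h2 := hτlow y
    simp only [hy] at h1
    exact abs_le.2 ⟨hτlow x, by linarith⟩
  obtain ⟨a, ha⟩ := exists_moebius_of_extremal hρ hτR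
    (fun x y => by
      by_cases hxy : x = y
      · simp [scaleFn, (hzero x y).2 hxy]
      · rw [scaleFn_eq_exp (hpos x y hxy), Real.exp_le_one_iff]
        have := hτ x y hxy
        linarith)
    (fun x ε hε => by
      obtain ⟨y, hxy, hy⟩ := hext x ε hε
      refine ⟨y, ?_⟩
      rw [scaleFn_eq_exp (hpos x y hxy)]
      have := Real.add_one_le_exp ((τ x + τ y) / 2 + Real.log (ρ x y))
      linarith)
  refine ⟨a, fun x => by rw [ha]; exact hτR x, fun x => ?_⟩
  rw [ha, abs_le]
  refine ⟨by linarith [hτσ x], ?_⟩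
  obtain ⟨y, hy⟩ := hattain x
  have hρxy : 0 < ρ x y := by
    refine lt_of_le_of_ne (hnonneg x y) fun h => ?_
    rw [scaleFn, ← h, mul_zero] at hy
    exact absurd hy (not_le.2 (Real.exp_pos _))
  rw [scaleFn_eq_exp hρxy, Real.exp_le_exp] at hy
  have h1 := hτ x y (hne_of_pos x y hρxy)
  have h2 := hτσ y
  linarith

theorem MoebiusSpace.scaleFn_le_one {Z : Type*} [TopologicalSpace Z] {ρ : Z → Z → ℝ}
    (a : MoebiusSpace ρ) (x y : Z) : scaleFn ρ a.1 x y ≤ 1 :=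
  a.2.2.1 x y

theorem MoebiusSpace.exists_lt_scaleFn {Z : Type*} [TopologicalSpace Z] {ρ : Z → Z → ℝ}
    (a : MoebiusSpace ρ) (x : Z) (ε : ℝ) (hε : 0 < ε) : ∃ y, 1 - ε < scaleFn ρ a.1 x y := by
  obtain ⟨y, hy⟩ := a.2.2.2 x
  exact ⟨y, by rw [hy]; linarith⟩

/-- Elements of the ball of radius `R` in the Moebius space are equicontinuous. -/
theorem MoebiusSpace.abs_sub_le {Z : Type*} [TopologicalSpace Z] {ρ : Z → Z → ℝ}
    (a : MoebiusSpace ρ) {R κ δ : ℝ} (hκ : Real.exp R * κ ≤ 1 - Real.exp (-δ / 2))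
    (hR : ∀ x, |a.1 x| ≤ R) {x y : Z} (hxy : ∀ z, |ρ x z - ρ y z| ≤ κ) :
    |a.1 x - a.1 y| ≤ δ :=
  abs_sub_le_of_variation_le hκ hR a.scaleFn_le_one a.exists_lt_scaleFn hxy

/-- Elements of the Moebius space of `Z₂` can be pulled back, up to a small error, along a map
`Z₁ → Z₂` which almost preserves the semi-metrics and is almost onto. -/
theorem exists_moebius_close_comp {Z₁ Z₂ : Type*} [TopologicalSpace Z₁] [CompactSpace Z₁]
    [TopologicalSpace Z₂] {ρ₁ : Z₁ → Z₁ → ℝ} {ρ₂ : Z₂ → Z₂ → ℝ}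
    (hρ₁ : IsAntipodalFn ρ₁) (hρ₂ : IsAntipodalFn ρ₂) {f : Z₁ → Z₂} {R κ δ : ℝ} (hδ : 0 < δ)
    (hκ0 : 0 ≤ κ) (hκ : Real.exp R * (2 * κ) ≤ 1 - Real.exp (-δ / 2))
    (hf : ∀ x y, |ρ₂ (f x) (f y) - ρ₁ x y| ≤ κ)
    (hnet : ∀ z, ∃ x, ∀ w, |ρ₂ (f x) w - ρ₂ z w| ≤ κ)
    (b : MoebiusSpace ρ₂) (hb : ∀ z, |b.1 z| ≤ R) :
    ∃ a : MoebiusSpace ρ₁, (∀ x, |a.1 x| ≤ R) ∧ ∀ x, |a.1 x - b.1 (f x)| ≤ 3 * δ := by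
  have hE : ∀ z w, Real.exp (b.1 z / 2) * Real.exp (b.1 w / 2) ≤ Real.exp R := fun z w => by
    rw [← Real.exp_add]
    exact Real.exp_le_exp.2 (by have := (abs_le.1 (hb z)).2; have := (abs_le.1 (hb w)).2; linarith)
  have hEκ := fun z w => mul_le_mul_of_nonneg_right (hE z w) hκ0
  have hRκ : 0 ≤ Real.exp R * κ := by positivity
  have hhalf : Real.exp (-δ / 2) * Real.exp (δ / 2) = 1 := by
    rw [← Real.exp_add]; ring_nf; exact Real.exp_zero
  refine exists_moebius_close_of_approx hρ₁ (σ := fun x => b.1 (f x)) hδ (fun x => hb _)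
    (fun x y => ?_) fun x => ?_
  · have h1 := b.scaleFn_le_one (f x) (f y)
    have h2 := mul_le_mul_of_nonneg_left (abs_le.1 (hf x y)).1
      (by positivity : 0 ≤ Real.exp (b.1 (f x) / 2) * Real.exp (b.1 (f y) / 2))
    have h3 := hEκ (f x) (f y)
    have h4 := Real.add_one_le_exp (-δ / 2)
    have h5 := Real.add_one_le_exp δ
    simp only [scaleFn] at h1 ⊢
    linarith
  · obtain ⟨z, hz⟩ := b.2.2.2 (f x)
    obtain ⟨y, hy⟩ := hnet z
    refine ⟨y, ?_⟩
    have h1 : |b.1 (f y) - b.1 z| ≤ δ := b.abs_sub_le (by linarith) hb hy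
    have h2 : ρ₂ (f x) z - 2 * κ ≤ ρ₁ x y := by
      have h3 := (abs_le.1 (hy (f x))).1
      rw [hρ₂.1.2.1 (f y), hρ₂.1.2.1 z] at h3
      have h4 := (abs_le.1 (hf x y)).2
      linarith
    have h3 := mul_le_mul_of_nonneg_left h2
      (by positivity : 0 ≤ Real.exp (b.1 (f x) / 2) * Real.exp (b.1 z / 2))
    have h4 := hEκ (f x) z
    simp only [scaleFn] at hz ⊢
    have h5 : Real.exp (-δ / 2) ≤ Real.exp (b.1 (f x) / 2) * Real.exp (b.1 z / 2) * ρ₁ x y := by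
      linarith
    have h6 : Real.exp (-δ / 2) * Real.exp (b.1 z / 2) ≤ Real.exp (b.1 (f y) / 2) := by
      rw [← Real.exp_add, Real.exp_le_exp]
      have := (abs_le.1 h1).1
      linarith
    have h7 := mul_le_mul_of_nonneg_left h6
      (by have := hρ₁.1.2.2.1 x y; positivity : 0 ≤ Real.exp (b.1 (f x) / 2) * ρ₁ x y)
    have h8 := mul_le_mul_of_nonneg_left h5 (Real.exp_pos (-δ / 2)).le
    rw [← Real.exp_add] at h8
    have e : -δ / 2 + -δ / 2 = -δ := by ring
    rw [e] at h8
    linarith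

theorem MoebiusSpace.dist_le_iff {Z : Type*} [TopologicalSpace Z] [CompactSpace Z]
    {ρ : Z → Z → ℝ} (a b : MoebiusSpace ρ) {C : ℝ} (hC : 0 ≤ C) :
    dist a b ≤ C ↔ ∀ x, |a.1 x - b.1 x| ≤ C :=
  ContinuousMap.dist_le (f := a.1) (g := b.1) hC

theorem MoebiusSpace.mem_closedBall_base_iff {Z : Type*} [TopologicalSpace Z] [CompactSpace Z]
    {ρ : Z → Z → ℝ} (hρ : IsAntipodalFn ρ) (a : MoebiusSpace ρ) {R : ℝ} (hR : 0 ≤ R) :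
    a ∈ Metric.closedBall (MoebiusBase ρ hρ) R ↔ ∀ x, |a.1 x| ≤ R := by
  rw [Metric.mem_closedBall, MoebiusSpace.dist_le_iff _ _ hR]
  exact forall_congr' fun x => by simp [MoebiusBase]

/-- A correspondence between two pointed metric spaces with small distortion yields a pointed
map of small distortion with almost dense image. -/
theorem exists_approximation_of_correspondence {A B : Type*} [MetricSpace A] [MetricSpace B]
    (r : A → B → Prop) {p : A} {q : B} (hpq : r p q) (hl : ∀ a, ∃ b, r a b) (hr : ∀ b, ∃ a, r a b)
    {ε : ℝ} (hdist : ∀ a a' b b', r a b → r a' b' → |dist b b' - dist a a'| < ε) :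
    ∃ f : A → B, f p = q ∧ (∀ a a', |dist (f a) (f a') - dist a a'| < ε) ∧
      ∀ b, ∃ a, dist (f a) b < ε := by
  classical
  choose g hg using hl
  have hf : ∀ a, r a (Function.update g p q a) := fun a => by
    by_cases h : a = p
    · subst h; simpa using hpq
    · simpa [h] using hg a
  refine ⟨Function.update g p q, Function.update_self .., fun a a' => hdist _ _ _ _ (hf a) (hf a'),
    fun b => ?_⟩
  obtain ⟨a, ha⟩ := hr b
  refine ⟨a, ?_⟩
  have := hdist _ _ _ _ (hf a) ha
  rw [dist_self, sub_zero] at this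
  exact (le_abs_self _).trans_lt this

/-- If a sequence of antipodal spaces `(Z n, ρ n)` AI-converges to an antipodal
space `(W, ρ₀)`, then the pointed Moebius spaces `(𝓜(Z n, ρ n), ρ n)` converge to
`(𝓜(W, ρ₀), ρ₀)` in the pointed Gromov–Hausdorff sense. -/
theorem moebius_spaces_GH_converge_of_AI_converges
    {Z : ℕ → Type u} [∀ n, TopologicalSpace (Z n)] [∀ n, CompactSpace (Z n)]
    [∀ n, TopologicalSpace.MetrizableSpace (Z n)]
    (ρ : ∀ n, Z n → Z n → ℝ) (hρ : ∀ n, IsAntipodalFn (ρ n))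
    {W : Type u} [TopologicalSpace W] [CompactSpace W] [TopologicalSpace.MetrizableSpace W]
    (ρ₀ : W → W → ℝ) (hρ₀ : IsAntipodalFn ρ₀)
    (hAI : AIConverges ρ ρ₀) :
    PointedGHConverges (fun n => MoebiusSpace (ρ n)) (fun n => MoebiusBase (ρ n) (hρ n))
      (MoebiusSpace ρ₀) (MoebiusBase ρ₀ hρ₀) := by
  intro R hR ε hε
  set δ : ℝ := ε / 40 with hδdef
  have hδ : 0 < δ := by positivity
  have hexp : 0 < 1 - Real.exp (-δ / 2) := by
    rw [sub_pos, Real.exp_lt_one_iff]; linarith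
  set κ : ℝ := (1 - Real.exp (-δ / 2)) / Real.exp R / 6 with hκdef
  have hκ : 0 < κ := by positivity
  have hκ6 : Real.exp R * (6 * κ) = 1 - Real.exp (-δ / 2) := by
    rw [hκdef]; field_simp
  have hRκ : 0 < Real.exp R * κ := by positivity
  obtain ⟨η, hη, hmod⟩ := hρ₀.1.exists_modulus hκ
  obtain ⟨e, -, he, hf⟩ := hAI
  obtain ⟨N, hN⟩ := eventually_atTop.1 (he.eventually_lt_const (lt_min hη hκ))
  refine ⟨N, fun n hn => ?_⟩
  obtain ⟨f, hfdist, hfnet⟩ := hf n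
  have hen := lt_min_iff.1 (hN n hn)
  have hf1 : ∀ x y, |ρ₀ (f x) (f y) - ρ n x y| ≤ κ := fun x y =>
    ((hfdist x y).trans hen.2).le
  have hf2 : ∀ w, ∃ x, ∀ z, |ρ₀ (f x) z - ρ₀ w z| ≤ κ := fun w =>
    (hfnet w).imp fun x hx => hmod _ _ (hx.trans hen.1)
  choose g hg using hf2
  have hsymm := hρ₀.1.2.1
  have hg1 : ∀ w w', |ρ n (g w) (g w') - ρ₀ w w'| ≤ 3 * κ := fun w w' => by
    have h1 := abs_le.1 (hf1 (g w) (g w'))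
    have h2 := abs_le.1 (hg w (f (g w')))
    have h3 := abs_le.1 (hg w' w)
    rw [hsymm _ w, hsymm w' w] at h3
    exact abs_le.2 ⟨by linarith, by linarith⟩
  have hg2 : ∀ x z, |ρ n (g (f x)) z - ρ n x z| ≤ 3 * κ := fun x z => by
    have h1 := abs_le.1 (hf1 (g (f x)) z)
    have h2 := abs_le.1 (hf1 x z)
    have h3 := abs_le.1 (hg (f x) (f z))
    exact abs_le.2 ⟨by linarith, by linarith⟩
  have hmem := fun a : MoebiusSpace (ρ n) => a.mem_closedBall_base_iff (hρ n) hR.le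
  have hmem₀ := fun b : MoebiusSpace ρ₀ => b.mem_closedBall_base_iff hρ₀ hR.le
  refine (exists_approximation_of_correspondence
    (fun (a : Metric.closedBall (MoebiusBase (ρ n) (hρ n)) R)
      (b : Metric.closedBall (MoebiusBase ρ₀ hρ₀) R) =>
        ∀ x, |a.1.1 x - b.1.1 (f x)| ≤ 4 * δ)
    (p := ⟨_, Metric.mem_closedBall_self hR.le⟩) (q := ⟨_, Metric.mem_closedBall_self hR.le⟩)
    (ε := ε) ?_ ?_ ?_ ?_).imp fun F hF => ⟨congrArg Subtype.val hF.1, hF.2.1, hF.2.2⟩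
  · intro x
    simp only [MoebiusBase, ContinuousMap.zero_apply, sub_zero, abs_zero]
    positivity
  · rintro ⟨a, ha⟩
    obtain ⟨b, hbR, hb⟩ := exists_moebius_close_comp hρ₀ (hρ n) (f := g) hδ (by positivity)
      (κ := 3 * κ) (by linarith) hg1 (fun x => ⟨f x, hg2 x⟩) a ((hmem a).1 ha)
    refine ⟨⟨b, (hmem₀ b).2 hbR⟩, fun x => ?_⟩
    have h1 := abs_le.1 (a.abs_sub_le (R := R) (δ := δ) (by linarith) ((hmem a).1 ha) (hg2 x))
    have h2 := abs_le.1 (hb (f x))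
    exact abs_le.2 ⟨by linarith, by linarith⟩
  · rintro ⟨b, hb⟩
    obtain ⟨a, haR, ha⟩ := exists_moebius_close_comp (hρ n) hρ₀ hδ hκ.le
      (by linarith) hf1 (fun w => ⟨g w, hg w⟩) b ((hmem₀ b).1 hb)
    exact ⟨⟨a, (hmem a).2 haR⟩, fun x => (ha x).trans (by linarith)⟩
  · rintro ⟨a, ha⟩ ⟨a', ha'⟩ ⟨b, hb⟩ ⟨b', hb'⟩ hab hab'
    simp only [Subtype.dist_eq] at hab hab' ⊢
    have h1 : dist a a' ≤ dist b b' + 8 * δ := by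
      refine (a.dist_le_iff a' (by positivity)).2 fun x => ?_
      have h2 := abs_le.1 (hab x)
      have h3 := abs_le.1 (hab' x)
      have h4 := abs_le.1 ((b.dist_le_iff b' dist_nonneg).1 le_rfl (f x))
      exact abs_le.2 ⟨by linarith, by linarith⟩
    have h2 : dist b b' ≤ dist a a' + 10 * δ := by
      refine (b.dist_le_iff b' (by positivity)).2 fun w => ?_
      have h2 := abs_le.1 (hab (g w))
      have h3 := abs_le.1 (hab' (g w))
      have h4 := abs_le.1 ((a.dist_le_iff a' dist_nonneg).1 le_rfl (g w))
      have h5 := abs_le.1 (b.abs_sub_le (R := R) (δ := δ) (by linarith) ((hmem₀ b).1 hb) (hg w))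
      have h6 := abs_le.1 (b'.abs_sub_le (R := R) (δ := δ) (by linarith) ((hmem₀ b').1 hb') (hg w))
      exact abs_le.2 ⟨by linarith, by linarith⟩
    exact abs_lt.2 ⟨by linarith, by linarith⟩
end

section
/- Let (X_n, x_n), n ≥ 1, be maximal Gromov product spaces and let (X, x) be a maximal Gromov product space whose Gromov product boundary ∂_P X is a finite set. If (X_n, x_n) → (X, x) in the pointed Gromov–Hausdorff sense, then (∂_P X_n, ρ_{x_n}) AI-converges to (∂_P X, ρ_x). -/
open Filter Topology Metric
open scoped ENNReal

universe u v

/-- A geodesic segment from `x` to `y`, parametrized by arclength on `[0, dist x y]`. -/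
def IsGeodesicSegment {X : Type*} [MetricSpace X] (γ : ℝ → X) (x y : X) : Prop :=
  γ 0 = x ∧ γ (dist x y) = y ∧
    ∀ s ∈ Set.Icc (0:ℝ) (dist x y), ∀ t ∈ Set.Icc (0:ℝ) (dist x y), dist (γ s) (γ t) = |s - t|

/-- A geodesic metric space: any two points are joined by a geodesic segment. -/
def IsGeodesicSpace (X : Type*) [MetricSpace X] : Prop :=
  ∀ x y : X, ∃ γ : ℝ → X, IsGeodesicSegment γ x y

/-- Geodesic completeness: any geodesic segment extends to a bi-infinite geodesic. -/
def IsGeodesicallyComplete (X : Type*) [MetricSpace X] : Prop :=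
  ∀ (x y : X) (γ : ℝ → X), IsGeodesicSegment γ x y →
    ∃ γ' : ℝ → X, (∀ s t : ℝ, dist (γ' s) (γ' t) = |s - t|) ∧
      ∀ s ∈ Set.Icc (0:ℝ) (dist x y), γ' s = γ s

/-- The data of a Gromov product space: a proper, geodesic, geodesically complete metric space
`X` together with a second countable Hausdorff compactification on which all the Gromov products
`(·|·)_x` extend continuously (with values in `[0, ∞]`), the extension being `∞` at a pair of
boundary points iff the two points coincide. -/
structure GromovProductData (X : Type u) [MetricSpace X] : Type (u + 1) where
  geodesic : IsGeodesicSpace X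
  geodesicallyComplete : IsGeodesicallyComplete X
  proper : ∀ (x : X) (r : ℝ), IsCompact (Metric.closedBall x r)
  Compactification : Type u
  [topC : TopologicalSpace Compactification]
  compactC : CompactSpace Compactification
  t2C : T2Space Compactification
  secondCountableC : SecondCountableTopology Compactification
  incl : X → Compactification
  isEmbedding_incl : Topology.IsEmbedding incl
  dense_incl : Dense (Set.range incl)
  Boundary : Type u
  [topB : TopologicalSpace Boundary]
  bIncl : Boundary → Compactification
  isEmbedding_bIncl : Topology.IsEmbedding bIncl
  range_bIncl : Set.range bIncl = (Set.range incl)ᶜ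
  gp : X → Compactification → Compactification → ℝ≥0∞
  continuous_gp : ∀ x : X,
    Continuous (fun pq : Compactification × Compactification => gp x pq.1 pq.2)
  gp_eq : ∀ x y z : X,
    gp x (incl y) (incl z) = ENNReal.ofReal ((dist y x + dist z x - dist y z) / 2)
  gp_top_iff : ∀ (x : X) (ξ η : Boundary), gp x (bIncl ξ) (bIncl η) = ⊤ ↔ ξ = η

attribute [instance] GromovProductData.topC GromovProductData.topB

/-- The visual antipodal function `ρ_x = exp (−(·|·)_x)` on the Gromov product boundary. -/
noncomputable def GromovProductData.visual {X : Type u} [MetricSpace X]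
    (D : GromovProductData X) (x : X) : D.Boundary → D.Boundary → ℝ :=
  fun ξ η =>
    if D.gp x (D.bIncl ξ) (D.bIncl η) = ⊤ then 0
    else Real.exp (-(D.gp x (D.bIncl ξ) (D.bIncl η)).toReal)

/-- Maximality of a Gromov product space, via the equivalent characterization: for every `x`,
the visual embedding `y ↦ ρ_y` is an isometry of `X` onto the Moebius space
`𝓜(∂_P X, ρ_x)`, i.e. it is isometric (the distance of `y, z` equals the sup-norm of
`log (dρ_z/dρ_y)`) and surjective onto the set of antipodal functions Moebius equivalent
to `ρ_x`. -/
def GromovProductData.IsMaximal {X : Type u} [MetricSpace X] (D : GromovProductData X) : Prop :=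
  ∀ x : X,
    (∀ y z : X, ∃ τ : D.Boundary → ℝ,
      (∀ ξ η, D.visual z ξ η ^ 2 = Real.exp (τ ξ) * Real.exp (τ η) * D.visual y ξ η ^ 2) ∧
      IsLUB (Set.range fun ξ => |τ ξ|) (dist y z)) ∧
    ∀ β : D.Boundary → D.Boundary → ℝ, IsAntipodalFn β →
      (∃ τ : D.Boundary → ℝ, Continuous τ ∧
        ∀ ξ η, β ξ η ^ 2 = Real.exp (τ ξ) * Real.exp (τ η) * D.visual x ξ η ^ 2) →
      ∃ y : X, D.visual y = β

lemma IsGeodesicSpace.exists_dist_eq_of_le {X : Type*} [MetricSpace X]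
    (hX : IsGeodesicSpace X) (p q : X) {s : ℝ} (hs : 0 ≤ s) (h : s ≤ dist p q) :
    ∃ r, dist p r = s ∧ dist r q = dist p q - s := by
  obtain ⟨γ, h0, h1, hγ⟩ := hX p q
  refine ⟨γ s, ?_, ?_⟩
  · have := hγ 0 ⟨le_rfl, dist_nonneg⟩ s ⟨hs, h⟩
    rw [h0] at this
    rw [this, zero_sub, abs_neg, abs_of_nonneg hs]
  · have := hγ s ⟨hs, h⟩ (dist p q) ⟨dist_nonneg, le_rfl⟩
    rw [h1] at this
    rw [this, abs_sub_comm, abs_of_nonneg (by linarith)]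

namespace GromovProductData

variable {X : Type u} [MetricSpace X] (D : GromovProductData X)

/-- The Busemann function of a boundary point, normalized so that it is the limit of
`dist w p - dist w q` as `w` tends to the boundary point. -/
noncomputable def busemann (ξ : D.Boundary) (p q : X) : ℝ :=
  2 * (D.gp p (D.bIncl ξ) (D.incl q)).toReal - dist q p

/-- Twice the Gromov product of two boundary points (with value `0` on the diagonal). -/
noncomputable def cost (p : X) (ξ η : D.Boundary) : ℝ :=
  2 * (D.gp p (D.bIncl ξ) (D.bIncl η)).toReal

lemma visual_eq (p : X) (ξ η : D.Boundary) [Decidable (ξ = η)] :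
    D.visual p ξ η = if ξ = η then 0 else Real.exp (-(D.cost p ξ η / 2)) := by
  unfold visual cost
  by_cases h : ξ = η
  · simp [h, (D.gp_top_iff p η η).2 rfl]
  · have h' : ¬ D.gp p (D.bIncl ξ) (D.bIncl η) = ⊤ := fun h' => h ((D.gp_top_iff p ξ η).1 h')
    simp [h, h']

lemma visual_self (p : X) (ξ : D.Boundary) : D.visual p ξ ξ = 0 := by
  classical simp [visual_eq]

lemma visual_of_ne (p : X) {ξ η : D.Boundary} (h : ξ ≠ η) :
    D.visual p ξ η = Real.exp (-(D.cost p ξ η / 2)) := by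
  classical simp [visual_eq, h]

lemma cost_nonneg (p : X) (ξ η : D.Boundary) : 0 ≤ D.cost p ξ η := by
  unfold cost; positivity

lemma visual_nonneg (p : X) (ξ η : D.Boundary) : 0 ≤ D.visual p ξ η := by
  classical
  rw [visual_eq]; split_ifs <;> positivity

lemma visual_le_one (p : X) (ξ η : D.Boundary) : D.visual p ξ η ≤ 1 := by
  classical
  have := D.cost_nonneg p ξ η
  rw [visual_eq]; split_ifs
  · norm_num
  · rw [Real.exp_le_one_iff]; linarith

/-- The filter on `X` of neighbourhoods of a boundary point. -/
noncomputable def approach (ξ : D.Boundary) : Filter X := comap D.incl (𝓝 (D.bIncl ξ))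

lemma approach_neBot (ξ : D.Boundary) : (D.approach ξ).NeBot :=
  IsDenseInducing.comap_nhds_neBot ⟨D.isEmbedding_incl.isInducing, D.dense_incl⟩ _

lemma tendsto_approach (ξ : D.Boundary) :
    Tendsto D.incl (D.approach ξ) (𝓝 (D.bIncl ξ)) := tendsto_comap

section Limits

variable {ι : Type*} {F : Filter ι} {w w' : ι → X} {ξ η : D.Boundary}

lemma tendsto_gp (p : X) {a b : D.Compactification}
    (hw : Tendsto (fun i => D.incl (w i)) F (𝓝 a))
    (hw' : Tendsto (fun i => D.incl (w' i)) F (𝓝 b)) :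
    Tendsto (fun i => ENNReal.ofReal ((dist (w i) p + dist (w' i) p - dist (w i) (w' i)) / 2)) F
      (𝓝 (D.gp p a b)) := by
  have := ((D.continuous_gp p).tendsto (a, b)).comp (hw.prodMk_nhds hw')
  simpa [Function.comp_def, D.gp_eq] using this

lemma tendsto_of_gp_ne_top (p : X) {a b : D.Compactification}
    (hw : Tendsto (fun i => D.incl (w i)) F (𝓝 a))
    (hw' : Tendsto (fun i => D.incl (w' i)) F (𝓝 b)) (h : D.gp p a b ≠ ⊤) :
    Tendsto (fun i => dist (w i) p + dist (w' i) p - dist (w i) (w' i)) F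
      (𝓝 (2 * (D.gp p a b).toReal)) := by
  have := ((ENNReal.tendsto_toReal h).comp (D.tendsto_gp p hw hw')).const_mul 2
  refine this.congr fun i => ?_
  have := dist_triangle (w i) p (w' i)
  rw [dist_comm p] at this
  rw [Function.comp, ENNReal.toReal_ofReal (by linarith)]
  ring

lemma tendsto_busemann [F.NeBot] (hw : Tendsto (fun i => D.incl (w i)) F (𝓝 (D.bIncl ξ)))
    (p q : X) :
    Tendsto (fun i => dist (w i) p - dist (w i) q) F (𝓝 (D.busemann ξ p q)) := by
  have hq : Tendsto (fun _ : ι => D.incl q) F (𝓝 (D.incl q)) := tendsto_const_nhds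
  have hle : D.gp p (D.bIncl ξ) (D.incl q) ≤ ENNReal.ofReal (dist q p) := by
    refine le_of_tendsto (D.tendsto_gp p hw hq) (Eventually.of_forall fun i => ?_)
    apply ENNReal.ofReal_le_ofReal
    have := dist_triangle (w i) q p
    linarith
  have := (D.tendsto_of_gp_ne_top p hw hq (ne_top_of_le_ne_top ENNReal.ofReal_ne_top hle)).sub_const
    (dist q p)
  refine this.congr fun i => by ring

lemma tendsto_cost (hw : Tendsto (fun i => D.incl (w i)) F (𝓝 (D.bIncl ξ)))
    (hw' : Tendsto (fun i => D.incl (w' i)) F (𝓝 (D.bIncl η))) (h : ξ ≠ η) (p : X) :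
    Tendsto (fun i => dist (w i) p + dist (w' i) p - dist (w i) (w' i)) F
      (𝓝 (D.cost p ξ η)) :=
  D.tendsto_of_gp_ne_top p hw hw' fun h' => h ((D.gp_top_iff p ξ η).1 h')

lemma tendsto_dist_atTop (hw : Tendsto (fun i => D.incl (w i)) F (𝓝 (D.bIncl ξ))) (p : X) :
    Tendsto (fun i => dist (w i) p) F atTop := by
  have := D.tendsto_gp p hw hw
  rw [(D.gp_top_iff p ξ ξ).2 rfl, ENNReal.tendsto_ofReal_nhds_top] at this
  refine this.congr fun i => ?_
  simp

lemma exists_boundary_eq [F.NeBot] {a : D.Compactification}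
    (hw : Tendsto (fun i => D.incl (w i)) F (𝓝 a)) (p : X)
    (hd : Tendsto (fun i => dist (w i) p) F atTop) : ∃ ξ, D.bIncl ξ = a := by
  by_contra hcon
  have ha : a ∉ Set.range D.bIncl := hcon
  rw [D.range_bIncl, Set.mem_compl_iff, not_not] at ha
  obtain ⟨q, rfl⟩ := ha
  have hq : Tendsto w F (𝓝 q) := D.isEmbedding_incl.tendsto_nhds_iff.2 hw
  exact not_tendsto_nhds_of_tendsto_atTop hd _ (hq.dist tendsto_const_nhds)

lemma exists_tendsto_boundary (U : Ultrafilter ι) (p : X)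
    (hd : Tendsto (fun i => dist (w i) p) U atTop) :
    ∃ ξ, Tendsto (fun i => D.incl (w i)) U (𝓝 (D.bIncl ξ)) := by
  have := D.compactC
  obtain ⟨a, -, ha⟩ := isCompact_univ.ultrafilter_le_nhds (U.map fun i => D.incl (w i)) (by simp)
  obtain ⟨ξ, rfl⟩ := D.exists_boundary_eq (F := (U : Filter ι)) ha p hd
  exact ⟨ξ, ha⟩

end Limits

lemma busemann_add (ξ : D.Boundary) (p q r : X) :
    D.busemann ξ p q + D.busemann ξ q r = D.busemann ξ p r := by
  have := D.approach_neBot ξ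
  have h := D.tendsto_busemann (D.tendsto_approach ξ)
  refine tendsto_nhds_unique (((h p q).add (h q r)).congr fun i => ?_) (h p r)
  ring

lemma abs_busemann_le (ξ : D.Boundary) (p q : X) : |D.busemann ξ p q| ≤ dist p q := by
  have := D.approach_neBot ξ
  refine le_of_tendsto (D.tendsto_busemann (D.tendsto_approach ξ) p q).abs
    (Eventually.of_forall fun w => ?_)
  rw [dist_comm w p, dist_comm w q]
  exact abs_dist_sub_le p q w

lemma busemann_le (ξ : D.Boundary) (p q : X) : D.busemann ξ p q ≤ dist p q :=
  (abs_le.1 (D.abs_busemann_le ξ p q)).2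

lemma neg_dist_le_busemann (ξ : D.Boundary) (p q : X) : -dist p q ≤ D.busemann ξ p q :=
  (abs_le.1 (D.abs_busemann_le ξ p q)).1

lemma busemann_self (ξ : D.Boundary) (p : X) : D.busemann ξ p p = 0 := by
  have := D.busemann_add ξ p p p
  linarith

lemma cost_comm (p : X) (ξ η : D.Boundary) : D.cost p ξ η = D.cost p η ξ := by
  by_cases h : ξ = η
  · rw [h]
  have := D.approach_neBot ξ
  have := D.approach_neBot η
  have h1 := (D.tendsto_approach ξ).comp (tendsto_fst (g := D.approach η))
  have h2 := (D.tendsto_approach η).comp (tendsto_snd (f := D.approach ξ))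
  refine tendsto_nhds_unique (D.tendsto_cost h1 h2 h p)
    ((D.tendsto_cost h2 h1 (Ne.symm h) p).congr fun i => ?_)
  rw [dist_comm i.2 i.1]; ring

lemma cost_change {ξ η : D.Boundary} (h : ξ ≠ η) (p q : X) :
    D.cost q ξ η = D.cost p ξ η - D.busemann ξ p q - D.busemann η p q := by
  have := D.approach_neBot ξ
  have := D.approach_neBot η
  have h1 := (D.tendsto_approach ξ).comp (tendsto_fst (g := D.approach η))
  have h2 := (D.tendsto_approach η).comp (tendsto_snd (f := D.approach ξ))
  refine tendsto_nhds_unique (D.tendsto_cost h1 h2 h q)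
    ((((D.tendsto_cost h1 h2 h p).sub (D.tendsto_busemann h1 p q)).sub
      (D.tendsto_busemann h2 p q)).congr fun i => ?_)
  ring

lemma busemann_add_le_cost {ξ η : D.Boundary} (h : ξ ≠ η) (p r : X) :
    D.busemann ξ p r + D.busemann η p r ≤ D.cost p ξ η := by
  have := D.cost_change h p r
  have := D.cost_nonneg r ξ η
  linarith

lemma busemann_add_sub_le_cost {ξ η : D.Boundary} (h : ξ ≠ η) (p r r' : X) :
    D.busemann ξ p r + D.busemann η p r' - dist r r' ≤ D.cost p ξ η := by
  have h1 := D.busemann_add_le_cost h p r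
  have h2 := D.busemann_add η p r r'
  have h3 := D.busemann_le η r r'
  linarith

/-- Any pair of points lies on a ray whose endpoint realizes the distance. -/
lemma exists_busemann_eq_dist (p q : X) : ∃ ξ, D.busemann ξ p q = dist p q := by
  obtain ⟨γ, hγ⟩ := D.geodesic p q
  obtain ⟨σ, hσ, hσγ⟩ := D.geodesicallyComplete p q γ hγ
  have hp : σ 0 = p := by rw [hσγ 0 ⟨le_rfl, dist_nonneg⟩, hγ.1]
  have hq : σ (dist p q) = q := by rw [hσγ _ ⟨dist_nonneg, le_rfl⟩, hγ.2.1]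
  let U : Ultrafilter ℝ := Ultrafilter.of atTop
  have hU : (U : Filter ℝ) ≤ atTop := Ultrafilter.of_le _
  have hd : Tendsto (fun t => dist (σ t) p) U atTop := by
    refine Tendsto.mono_left ?_ hU
    refine tendsto_abs_atTop_atTop.congr fun t => ?_
    rw [← hp, hσ]; simp
  obtain ⟨ξ, hξ⟩ := D.exists_tendsto_boundary U p hd
  refine ⟨ξ, tendsto_nhds_unique (D.tendsto_busemann hξ p q) ?_⟩
  refine tendsto_const_nhds.congr' ?_
  filter_upwards [hU (eventually_ge_atTop (dist p q))] with t ht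
  have h1 : dist (σ t) p = t := by
    rw [← hp, hσ, sub_zero, abs_of_nonneg (dist_nonneg.trans ht)]
  have h2 : dist (σ t) q = t - dist p q := by
    rw [← hq, hσ, hq, abs_of_nonneg (by linarith)]
  rw [h1, h2]; ring

/-- Points at prescribed distance on a ray to a boundary point. -/
lemma exists_dist_eq_busemann_eq (p : X) (ξ : D.Boundary) {s : ℝ} (hs : 0 ≤ s) :
    ∃ r, dist p r = s ∧ D.busemann ξ p r = s := by
  have := D.approach_neBot ξ
  let U : Ultrafilter X := Ultrafilter.of (D.approach ξ)
  have hU : (U : Filter X) ≤ D.approach ξ := Ultrafilter.of_le _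
  have hlim : Tendsto (fun w => D.incl w) U (𝓝 (D.bIncl ξ)) := (D.tendsto_approach ξ).mono_left hU
  have hex : ∀ w : X, ∃ r, s ≤ dist p w → dist p r = s ∧ dist r w = dist p w - s := by
    intro w
    by_cases h : s ≤ dist p w
    · obtain ⟨r, hr⟩ := D.geodesic.exists_dist_eq_of_le p w hs h
      exact ⟨r, fun _ => hr⟩
    · exact ⟨p, fun h' => absurd h' h⟩
  choose π hπ using hex
  have hev : ∀ᶠ w in (U : Filter X), s ≤ dist p w := by
    filter_upwards [(D.tendsto_dist_atTop hlim p).eventually_ge_atTop s] with w hw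
    rwa [dist_comm]
  obtain ⟨r, -, hr⟩ := (D.proper p s).ultrafilter_le_nhds (U.map π) (by
    rw [le_principal_iff]
    show ∀ᶠ w in (U : Filter X), π w ∈ closedBall p s
    filter_upwards [hev] with w hw
    rw [mem_closedBall, dist_comm, (hπ w hw).1])
  have hr' : Tendsto π U (𝓝 r) := hr
  refine ⟨r, ?_, ?_⟩
  · refine tendsto_nhds_unique (tendsto_const_nhds.dist hr' : Tendsto (fun w => dist p (π w)) U _) ?_
    refine tendsto_const_nhds.congr' ?_
    filter_upwards [hev] with w hw
    exact (hπ w hw).1.symm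
  · have h1 := D.tendsto_busemann hlim p r
    have h2 : Tendsto (fun w => dist (π w) w - dist w r) U (𝓝 0) := by
      refine squeeze_zero_norm (a := fun w => dist (π w) r) (fun w => ?_) ?_
      · rw [Real.norm_eq_abs, dist_comm w r]
        exact abs_dist_sub_le _ _ _
      · simpa using hr'.dist (tendsto_const_nhds (x := r))
    have h3 := h1.sub h2
    rw [sub_zero] at h3
    refine tendsto_nhds_unique h3 (tendsto_const_nhds.congr' ?_)
    filter_upwards [hev] with w hw
    rw [(hπ w hw).2, dist_comm w p]; ring

lemma exists_antipode (p : X) (ξ : D.Boundary) : ∃ η, ξ ≠ η ∧ D.cost p ξ η = 0 := by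
  have := D.approach_neBot ξ
  let U : Ultrafilter X := Ultrafilter.of (D.approach ξ)
  have hU : (U : Filter X) ≤ D.approach ξ := Ultrafilter.of_le _
  have hlim : Tendsto (fun w => D.incl w) U (𝓝 (D.bIncl ξ)) := (D.tendsto_approach ξ).mono_left hU
  have hex : ∀ w : X, ∃ v, dist v p = dist w p ∧ dist w v = 2 * dist w p := by
    intro w
    obtain ⟨γ, hγ⟩ := D.geodesic p w
    obtain ⟨σ, hσ, hσγ⟩ := D.geodesicallyComplete p w γ hγ
    have hp : σ 0 = p := by rw [hσγ 0 ⟨le_rfl, dist_nonneg⟩, hγ.1]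
    have hq : σ (dist p w) = w := by rw [hσγ _ ⟨dist_nonneg, le_rfl⟩, hγ.2.1]
    have hd : 0 ≤ dist p w := dist_nonneg
    refine ⟨σ (-dist p w), ?_, ?_⟩
    · nth_rewrite 2 [← hp]
      rw [hσ, sub_zero, abs_neg, abs_of_nonneg hd, dist_comm]
    · nth_rewrite 1 [← hq]
      rw [hσ, sub_neg_eq_add, abs_of_nonneg (by linarith), dist_comm]; ring
  choose v hv hv' using hex
  obtain ⟨η, hη⟩ := D.exists_tendsto_boundary (w := v) U p
    ((D.tendsto_dist_atTop hlim p).congr fun w => (hv w).symm)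
  have hgp : D.gp p (D.bIncl ξ) (D.bIncl η) = 0 := by
    refine tendsto_nhds_unique (D.tendsto_gp p hlim hη) (tendsto_const_nhds.congr fun w => ?_)
    rw [hv, hv', eq_comm, ENNReal.ofReal_eq_zero]
    linarith
  refine ⟨η, fun h => ?_, by simp [cost, hgp]⟩
  rw [(D.gp_top_iff p ξ η).2 h] at hgp
  exact ENNReal.top_ne_zero hgp

lemma visual_eq_toReal_exp (p : X) (ξ η : D.Boundary) :
    D.visual p ξ η = (EReal.exp (-(D.gp p (D.bIncl ξ) (D.bIncl η) : EReal))).toReal := by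
  unfold visual
  split_ifs with h
  · simp [h]
  · lift D.gp p (D.bIncl ξ) (D.bIncl η) to NNReal using h with t
    have : (-((t : ℝ≥0∞) : EReal)) = ((-(t : ℝ) : ℝ) : EReal) := by
      simp [EReal.coe_nnreal_eq_coe_real]
    rw [this, EReal.exp_coe, ENNReal.toReal_ofReal (Real.exp_pos _).le]
    simp

lemma continuous_visual (p : X) : Continuous (Function.uncurry (D.visual p)) := by
  have h : Continuous fun x : D.Boundary × D.Boundary =>
      EReal.exp (-(D.gp p (D.bIncl x.1) (D.bIncl x.2) : EReal)) := by
    refine ENNReal.continuous_exp.comp (continuous_neg.comp (continuous_coe_ennreal_ereal.comp ?_))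
    exact (D.continuous_gp p).comp (D.isEmbedding_bIncl.continuous.prodMap
      D.isEmbedding_bIncl.continuous)
  have : Function.uncurry (D.visual p) = fun x : D.Boundary × D.Boundary =>
      (EReal.exp (-(D.gp p (D.bIncl x.1) (D.bIncl x.2) : EReal))).toReal := by
    ext x; exact D.visual_eq_toReal_exp p x.1 x.2
  rw [this, continuous_iff_continuousAt]
  intro x
  refine (ENNReal.tendsto_toReal ?_).comp h.continuousAt
  refine ne_top_of_le_ne_top ENNReal.one_ne_top ?_
  rw [← EReal.exp_zero]
  refine EReal.exp_monotone ?_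
  simpa using EReal.coe_ennreal_nonneg _

lemma compactSpace_boundary [Nonempty X] : CompactSpace D.Boundary := by
  have := D.compactC
  obtain ⟨p⟩ := ‹Nonempty X›
  have : Set.range D.bIncl = {a | D.gp p a a = ⊤} := by
    ext a
    constructor
    · rintro ⟨ξ, rfl⟩
      exact (D.gp_top_iff p ξ ξ).2 rfl
    · intro h
      rw [D.range_bIncl]
      rintro ⟨q, rfl⟩
      rw [Set.mem_ofPred_eq, D.gp_eq] at h
      exact ENNReal.ofReal_ne_top h
  have hcl : IsClosed (Set.range D.bIncl) := by
    rw [this]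
    exact isClosed_eq ((D.continuous_gp p).comp (continuous_id.prodMk continuous_id))
      continuous_const
  exact (Topology.IsClosedEmbedding.mk D.isEmbedding_bIncl hcl).compactSpace

end GromovProductData

namespace GromovProductData

variable {X : Type u} [MetricSpace X] (D : GromovProductData X)

/-- The cost `cost p` truncated at `4`; this is continuous on all pairs of boundary points. -/
noncomputable def truncCost (p : X) (ξ η : D.Boundary) : ℝ :=
  -2 * Real.log (max (D.visual p ξ η) (Real.exp (-2)))

lemma continuous_truncCost (p : X) : Continuous (Function.uncurry (D.truncCost p)) := by
  refine continuous_const.mul (Continuous.log ((D.continuous_visual p).max continuous_const) ?_)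
  intro x
  exact (lt_max_of_lt_right (Real.exp_pos _)).ne'

lemma truncCost_of_ne (p : X) {ξ η : D.Boundary} (h : ξ ≠ η) :
    D.truncCost p ξ η = min (D.cost p ξ η) 4 := by
  unfold truncCost
  rw [D.visual_of_ne p h, ← Real.exp_monotone.map_max, Real.log_exp]
  rcases le_total (D.cost p ξ η) 4 with h | h
  · rw [min_eq_left h, max_eq_left (by linarith)]; ring
  · rw [min_eq_right h, max_eq_right (by linarith)]; ring

lemma truncCost_nonneg (p : X) (ξ η : D.Boundary) : 0 ≤ D.truncCost p ξ η := by
  unfold truncCost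
  have : Real.log (max (D.visual p ξ η) (Real.exp (-2))) ≤ 0 := by
    refine Real.log_nonpos (le_max_of_le_left (D.visual_nonneg p ξ η))
      (max_le (D.visual_le_one p ξ η) ?_)
    rw [Real.exp_le_one_iff]; norm_num
  linarith

/-- If the boundary splits into two clopen pieces, each of small visual diameter, then there are
continuous potentials adapted to the cost which see the cost of a given pair of points in
opposite pieces. -/
lemma exists_potential [CompactSpace D.Boundary] (p : X) {A : Set D.Boundary} (hA : IsClopen A)
    (hAA : ∀ a ∈ A, ∀ b ∈ A, a ≠ b → 7 ≤ D.cost p a b)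
    (hBB : ∀ a ∈ Aᶜ, ∀ b ∈ Aᶜ, a ≠ b → 7 ≤ D.cost p a b)
    {ξ η : D.Boundary} (hξ : ξ ∈ A) (hη : η ∈ Aᶜ) :
    ∃ τ : D.Boundary → ℝ, Continuous τ ∧ (∀ z, |τ z| ≤ 1) ∧
      (∀ z w, z ≠ w → τ z + τ w ≤ D.cost p z w) ∧
      (∀ z, ∃ w, z ≠ w ∧ τ z + τ w = D.cost p z w) ∧
      min (D.cost p ξ η) 1 ≤ τ ξ + τ η := by
  classical
  have hne : ∀ a ∈ A, ∀ b ∈ Aᶜ, a ≠ b := fun a ha b hb h => hb (h ▸ ha)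
  have hAcpt : IsCompact A := hA.isClosed.isCompact
  have hBcpt : IsCompact Aᶜ := hA.compl.isClosed.isCompact
  set k := D.truncCost p with hk
  have hkc : Continuous (Function.uncurry k) := D.continuous_truncCost p
  have hkle : ∀ a ∈ A, ∀ b ∈ Aᶜ, k a b ≤ D.cost p a b := fun a ha b hb => by
    rw [hk, D.truncCost_of_ne p (hne a ha b hb)]; exact min_le_left _ _
  have hkeq : ∀ a ∈ A, ∀ b ∈ Aᶜ, k a b ≤ 1 → k a b = D.cost p a b := fun a ha b hb h => by
    rw [hk, D.truncCost_of_ne p (hne a ha b hb)] at h ⊢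
    rcases le_total (D.cost p a b) 4 with h' | h'
    · rw [min_eq_left h']
    · rw [min_eq_right h'] at h; norm_num at h
  have hk0 : ∀ a b, 0 ≤ k a b := D.truncCost_nonneg p
  have hantiA : ∀ a ∈ A, ∃ b ∈ Aᶜ, k a b = 0 := fun a ha => by
    obtain ⟨b, hab, hb⟩ := D.exists_antipode p a
    have hbA : b ∈ Aᶜ := fun hbA => by
      have := hAA a ha b hbA hab
      linarith
    refine ⟨b, hbA, ?_⟩
    rw [hk, D.truncCost_of_ne p hab, hb]; norm_num
  have hantiB : ∀ b ∈ Aᶜ, ∃ a ∈ A, k a b = 0 := fun b hb => by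
    obtain ⟨a, hba, ha⟩ := D.exists_antipode p b
    have haA : a ∈ A := by
      by_contra haA
      have := hBB b hb a haA hba
      linarith
    refine ⟨a, haA, ?_⟩
    rw [hk, D.truncCost_of_ne p hba.symm, D.cost_comm, ha]; norm_num
  set h : D.Boundary → ℝ := fun w => min (k ξ w) 1 with hh
  have hhc : Continuous h := (hkc.comp (continuous_const.prodMk continuous_id)).min continuous_const
  set g : D.Boundary → ℝ := fun z => sInf ((fun w => k z w - h w) '' Aᶜ) with hg
  have hgc : Continuous g :=
    hBcpt.continuous_sInf (f := fun z w => k z w - h w) (hkc.sub (hhc.comp continuous_snd))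
  set l : D.Boundary → ℝ := fun z => sInf ((fun w => k w z - g w) '' A) with hl
  have hlc : Continuous l :=
    hAcpt.continuous_sInf (f := fun z w => k w z - g w)
      ((hkc.comp continuous_swap).sub (hgc.comp continuous_snd))
  have cont1 : ∀ z, ContinuousOn (fun w => k z w - h w) Aᶜ := fun z =>
    ((hkc.comp (continuous_const.prodMk continuous_id)).sub hhc).continuousOn
  have cont2 : ∀ z, ContinuousOn (fun w => k w z - g w) A := fun z =>
    ((hkc.comp (continuous_id.prodMk continuous_const)).sub hgc).continuousOn
  have g_le : ∀ a, ∀ b ∈ Aᶜ, g a ≤ k a b - h b := fun a b hb =>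
    csInf_le (hBcpt.bddBelow_image (cont1 a)) ⟨b, hb, rfl⟩
  have l_le : ∀ b, ∀ a ∈ A, l b ≤ k a b - g a := fun b a ha =>
    csInf_le (hAcpt.bddBelow_image (cont2 b)) ⟨a, ha, rfl⟩
  have g_att : ∀ a, ∃ b ∈ Aᶜ, g a = k a b - h b := fun a => by
    obtain ⟨b, hb, hb', -⟩ := hBcpt.exists_sInf_image_eq_and_le ⟨η, hη⟩ (cont1 a)
    exact ⟨b, hb, hb'⟩
  have l_att : ∀ b, ∃ a ∈ A, l b = k a b - g a := fun b => by
    obtain ⟨a, ha, ha', -⟩ := hAcpt.exists_sInf_image_eq_and_le ⟨ξ, hξ⟩ (cont2 b)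
    exact ⟨a, ha, ha'⟩
  have h0 : ∀ w, 0 ≤ h w := fun w => le_min (hk0 _ _) zero_le_one
  have h1 : ∀ w, h w ≤ 1 := fun w => min_le_right _ _
  have g0 : ∀ a ∈ A, g a ≤ 0 := fun a ha => by
    obtain ⟨b, hb, hb'⟩ := hantiA a ha
    have := g_le a b hb
    have := h0 b
    linarith
  have g1 : ∀ a, -1 ≤ g a := fun a => by
    obtain ⟨b, hb, hb'⟩ := g_att a
    have := h1 b
    have := hk0 a b
    linarith
  have l_ge : ∀ b ∈ Aᶜ, h b ≤ l b := fun b hb => by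
    obtain ⟨a, ha, ha'⟩ := l_att b
    have := g_le a b hb
    linarith
  have l1 : ∀ b ∈ Aᶜ, l b ≤ 1 := fun b hb => by
    obtain ⟨a, ha, ha'⟩ := hantiB b hb
    have := l_le b a ha
    have := g1 a
    linarith
  have gξ : 0 ≤ g ξ := by
    obtain ⟨b, hb, hb'⟩ := g_att ξ
    have : h b ≤ k ξ b := min_le_left _ _
    linarith
  have τA : ∀ a ∈ A, A.piecewise g l a = g a := fun a ha => Set.piecewise_eq_of_mem _ _ _ ha
  have τB : ∀ b ∈ Aᶜ, A.piecewise g l b = l b := fun b hb => Set.piecewise_eq_of_notMem _ _ _ hb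
  have hAB : ∀ a ∈ A, ∀ b ∈ Aᶜ, g a + l b ≤ D.cost p a b := fun a ha b hb => by
    have := l_le b a ha
    have := hkle a ha b hb
    linarith
  refine ⟨A.piecewise g l, ?_, ?_, ?_, ?_, ?_⟩
  · refine Continuous.piecewise (fun a ha => ?_) hgc hlc
    rw [hA.frontier_eq] at ha
    exact absurd ha (Set.notMem_empty a)
  · intro z
    by_cases hz : z ∈ A
    · rw [τA z hz, abs_le]
      exact ⟨g1 z, (g0 z hz).trans zero_le_one⟩
    · rw [τB z hz, abs_le]
      exact ⟨by linarith [h0 z, l_ge z hz], l1 z hz⟩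
  · intro z w hzw
    by_cases hz : z ∈ A <;> by_cases hw : w ∈ A
    · rw [τA z hz, τA w hw]
      linarith [g0 z hz, g0 w hw, D.cost_nonneg p z w]
    · rw [τA z hz, τB w hw]
      exact hAB z hz w hw
    · rw [τB z hz, τA w hw, add_comm, D.cost_comm]
      exact hAB w hw z hz
    · rw [τB z hz, τB w hw]
      linarith [l1 z hz, l1 w hw, hBB z hz w hw hzw]
  · intro z
    by_cases hz : z ∈ A
    · obtain ⟨b, hb, hb'⟩ := g_att z
      refine ⟨b, hne z hz b hb, ?_⟩
      rw [τA z hz, τB b hb]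
      have e1 := l_ge b hb
      have e2 := l_le b z hz
      have e3 := hkeq z hz b hb (by linarith [h1 b, g0 z hz])
      linarith
    · obtain ⟨a, ha, ha'⟩ := l_att z
      refine ⟨a, (hne a ha z hz).symm, ?_⟩
      rw [τA a ha, τB z hz, D.cost_comm]
      have e3 := hkeq a ha z hz (by linarith [l1 z hz, g0 a ha])
      linarith
  · rw [τA ξ hξ, τB η hη]
    have e1 := l_ge η hη
    have e2 : h η = min (D.cost p ξ η) 1 := by
      show min (k ξ η) 1 = _
      rw [hk, D.truncCost_of_ne p (hne ξ hξ η hη), min_assoc]; norm_num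
    linarith

/-- In a maximal Gromov product space, potentials adapted to the cost are realized by points. -/
lemma IsMaximal.exists_point {D : GromovProductData X} (hD : D.IsMaximal) (p : X)
    {τ : D.Boundary → ℝ} (hτ : Continuous τ)
    (hle : ∀ z w, z ≠ w → τ z + τ w ≤ D.cost p z w)
    (heq : ∀ z, ∃ w, z ≠ w ∧ τ z + τ w = D.cost p z w) :
    ∃ q, ∀ z w, z ≠ w → D.busemann z p q + D.busemann w p q = τ z + τ w := by
  let β : D.Boundary → D.Boundary → ℝ := fun z w => Real.exp ((τ z + τ w) / 2) * D.visual p z w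
  have hβne : ∀ z w, z ≠ w → β z w = Real.exp ((τ z + τ w - D.cost p z w) / 2) := fun z w h => by
    simp only [β]
    rw [D.visual_of_ne p h, ← Real.exp_add]; congr 1; ring
  have hβself : ∀ z, β z z = 0 := fun z => by simp only [β]; rw [D.visual_self, mul_zero]
  have hβ : IsAntipodalFn β := by
    refine ⟨⟨?_, ?_, ?_, ?_⟩, ?_, ?_⟩
    · refine Continuous.mul ?_ (D.continuous_visual p)
      fun_prop
    · intro z w
      by_cases h : z = w
      · rw [h]
      · rw [hβne z w h, hβne w z (Ne.symm h), D.cost_comm, add_comm]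
    · intro z w
      exact mul_nonneg (Real.exp_pos _).le (D.visual_nonneg _ _ _)
    · intro z w
      by_cases h : z = w
      · simp [h, hβself]
      · rw [hβne z w h]
        simp [h]
    · intro z w
      by_cases h : z = w
      · rw [h, hβself]; exact zero_le_one
      · rw [hβne z w h, Real.exp_le_one_iff]
        linarith [hle z w h]
    · intro z
      obtain ⟨w, hzw, hw⟩ := heq z
      refine ⟨w, ?_⟩
      rw [hβne z w hzw, hw, sub_self, zero_div, Real.exp_zero]
  obtain ⟨q, hq⟩ := (hD p).2 β hβ ⟨τ, hτ, fun z w => by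
    simp only [β]
    rw [mul_pow, ← Real.exp_nat_mul, ← Real.exp_add]
    congr 2; push_cast; ring⟩
  refine ⟨q, fun z w hzw => ?_⟩
  have h1 := congrFun (congrFun hq z) w
  rw [hβne z w hzw, D.visual_of_ne q hzw, Real.exp_eq_exp] at h1
  have h2 := D.cost_change hzw p q
  linarith

/-- In a maximal Gromov product space, suppose that the boundary splits at `p` into two pieces of
small visual diameter. If two boundary points in opposite pieces have positive Gromov product at
`p`, then some point near `p` detects this. -/
lemma IsMaximal.exists_detecting_point {D : GromovProductData X} (hD : D.IsMaximal) (p : X)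
    {A : Set D.Boundary} (hA : IsClopen A)
    (hAA : ∀ a ∈ A, ∀ b ∈ A, a ≠ b → 7 ≤ D.cost p a b)
    (hBB : ∀ a ∈ Aᶜ, ∀ b ∈ Aᶜ, a ≠ b → 7 ≤ D.cost p a b)
    {ξ η : D.Boundary} (hξ : ξ ∈ A) (hη : η ∈ Aᶜ) (hpos : 0 < D.cost p ξ η) :
    ∃ q, dist p q ≤ 1 ∧ min (D.cost p ξ η) 1 ≤ D.busemann ξ p q + D.busemann η p q := by
  have : Nonempty X := ⟨p⟩
  have := D.compactSpace_boundary
  obtain ⟨τ, hτ, hτ1, hle, heq, hτξη⟩ := D.exists_potential p hA hAA hBB hξ hη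
  obtain ⟨q, hq⟩ := hD.exists_point p hτ hle heq
  have hξη : ξ ≠ η := fun h => hη (h ▸ hξ)
  refine ⟨q, ?_, by rw [hq ξ η hξη]; exact hτξη⟩
  obtain ⟨ζ, hξζ, hζ⟩ := D.exists_antipode p ξ
  have hηζ : η ≠ ζ := fun h => by rw [← h] at hζ; linarith
  have key : ∀ u v w, u ≠ v → v ≠ w → u ≠ w → D.busemann u p q = τ u := fun u v w huv hvw huw => by
    have h1 := hq u v huv
    have h2 := hq v w hvw
    have h3 := hq u w huw
    linarith
  obtain ⟨ω, hω⟩ := D.exists_busemann_eq_dist p q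
  have : D.busemann ω p q = τ ω := by
    by_cases h1 : ω = ξ
    · subst h1; exact key _ η ζ hξη hηζ hξζ
    · by_cases h2 : ω = η
      · subst h2; exact key _ ξ ζ hξη.symm hξζ hηζ
      · exact key _ ξ η h1 hξη h2
  rw [← hω, this]
  exact (abs_le.1 (hτ1 ω)).2

end GromovProductData

/-- The function `φ` is, up to the error `ε`, an isometric coordinate vanishing at `p` on the ball of
radius `4` about `p`. -/
def IsAlmostCoordinate {X : Type*} [MetricSpace X] (p : X) (ε : ℝ) (φ : X → ℝ) : Prop :=
  φ p = 0 ∧ ∀ a b, dist p a ≤ 4 → dist p b ≤ 4 → |(|φ a - φ b| - dist a b)| ≤ ε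

lemma IsAlmostCoordinate.neg {X : Type*} [MetricSpace X] {p : X} {ε : ℝ} {φ : X → ℝ}
    (h : IsAlmostCoordinate p ε φ) : IsAlmostCoordinate p ε (-φ) := by
  refine ⟨by simp [h.1], fun a b ha hb => ?_⟩
  have := h.2 a b ha hb
  rwa [Pi.neg_apply, Pi.neg_apply, neg_sub_neg, abs_sub_comm (φ b)]

namespace GromovProductData

variable {X : Type u} [MetricSpace X] (D : GromovProductData X)

/-- Some ray from `p` to `ξ` sets out in the direction in which `φ` is positive. -/
def HeadsUp (p : X) (φ : X → ℝ) (ξ : D.Boundary) : Prop :=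
  ∃ r, dist p r = 4 ∧ D.busemann ξ p r = 4 ∧ 0 < φ r

variable {D} {p : X} {ε : ℝ} {φ : X → ℝ}

lemma headsUp_or (hφ : IsAlmostCoordinate p ε φ) (hε : ε ≤ 1 / 30) (ξ : D.Boundary) :
    D.HeadsUp p φ ξ ∨ D.HeadsUp p (-φ) ξ := by
  obtain ⟨r, hr, hr'⟩ := D.exists_dist_eq_busemann_eq p ξ (s := 4) (by norm_num)
  rcases lt_trichotomy (φ r) 0 with h | h | h
  · exact Or.inr ⟨r, hr, hr', by simpa using h⟩
  · have := hφ.2 p r (by simp) hr.le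
    rw [hφ.1, h, hr] at this
    norm_num at this
    linarith
  · exact Or.inl ⟨r, hr, hr', h⟩

lemma abs_sub_four_le (hφ : IsAlmostCoordinate p ε φ) {r : X} (hr : dist p r = 4)
    (h : 0 < φ r) : |φ r - 4| ≤ ε := by
  have := hφ.2 p r (by simp) hr.le
  rwa [hφ.1, zero_sub, abs_neg, abs_of_pos h, hr] at this

lemma HeadsUp.seven_le_cost (hφ : IsAlmostCoordinate p ε φ) (hε : ε ≤ 1 / 30) {ξ η : D.Boundary}
    (hξ : D.HeadsUp p φ ξ) (hη : D.HeadsUp p φ η) (h : ξ ≠ η) : 7 ≤ D.cost p ξ η := by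
  obtain ⟨r, hr, hr', hr0⟩ := hξ
  obtain ⟨s, hs, hs', hs0⟩ := hη
  have h1 := D.busemann_add_sub_le_cost h p r s
  have h2 := abs_le.1 (hφ.2 r s hr.le hs.le)
  have h3 := abs_le.1 (abs_sub_four_le hφ hr hr0)
  have h4 := abs_le.1 (abs_sub_four_le hφ hs hs0)
  have h5 : |φ r - φ s| ≤ 2 * ε := abs_le.2 ⟨by linarith, by linarith⟩
  linarith

lemma HeadsUp.not_headsUp_neg (hφ : IsAlmostCoordinate p ε φ) (hε : ε ≤ 1 / 30) {ξ : D.Boundary}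
    (hξ : D.HeadsUp p φ ξ) : ¬ D.HeadsUp p (-φ) ξ := by
  intro hξ'
  obtain ⟨η, hne, hη⟩ := D.exists_antipode p ξ
  rcases headsUp_or (D := D) hφ hε η with h | h
  · have := hξ.seven_le_cost hφ hε h hne
    linarith
  · have := hξ'.seven_le_cost hφ.neg hε h hne
    linarith

lemma isOpen_headsUp (hφ : IsAlmostCoordinate p ε φ) (hε : ε ≤ 1 / 30) :
    IsOpen {ξ | D.HeadsUp p φ ξ} := by
  rw [isOpen_iff_mem_nhds]
  intro ξ hξ
  obtain ⟨η, hne, hη⟩ := D.exists_antipode p ξ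
  have hvis : D.visual p ξ η = 1 := by
    rw [D.visual_of_ne p hne, hη]; norm_num
  have hcont : Continuous fun z => D.visual p z η :=
    (D.continuous_visual p).comp (continuous_id.prodMk continuous_const)
  have hη' : D.HeadsUp p (-φ) η := by
    refine (headsUp_or hφ hε η).resolve_left fun h => ?_
    have := HeadsUp.seven_le_cost hφ hε hξ h hne
    linarith
  have hlt : Real.exp (-1) < D.visual p ξ η := by
    rw [hvis, Real.exp_lt_one_iff]; norm_num
  filter_upwards [hcont.continuousAt.eventually (lt_mem_nhds hlt)] with z hz
  refine (headsUp_or hφ hε z).resolve_right fun h => ?_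
  have hzη : z ≠ η := by
    rintro rfl
    rw [D.visual_self] at hz
    exact absurd hz (Real.exp_pos _).le.not_gt
  have := h.seven_le_cost hφ.neg hε hη' hzη
  rw [D.visual_of_ne p hzη, Real.exp_lt_exp] at hz
  linarith

lemma HeadsUp.le_busemann (hφ : IsAlmostCoordinate p ε φ) {ξ : D.Boundary}
    (hξ : D.HeadsUp p φ ξ) (hε : ε ≤ 1 / 30) {q : X} (hq : dist p q ≤ 1) :
    φ q - 2 * ε ≤ D.busemann ξ p q := by
  obtain ⟨r, hr, hr', hr0⟩ := hξ
  have h1 := D.busemann_add ξ p q r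
  have h2 := D.busemann_le ξ q r
  have h3 := abs_le.1 (hφ.2 q r (by linarith) hr.le)
  have h4 := abs_le.1 (abs_sub_four_le hφ hr hr0)
  have h5 := abs_le.1 (hφ.2 p q (by simp) (by linarith))
  rw [hφ.1, zero_sub, abs_neg] at h5
  have h6 := le_abs_self (φ q)
  have h7 : |φ q - φ r| = φ r - φ q := by
    rw [abs_sub_comm, abs_of_nonneg]; linarith
  linarith

/-- Opposite boundary points at a line-like point of a maximal Gromov product space have almost
zero Gromov product. -/
lemma IsMaximal.cost_le (hD : D.IsMaximal) (hφ : IsAlmostCoordinate p ε φ) (hε : ε ≤ 1 / 30)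
    {ξ η : D.Boundary} (hξ : D.HeadsUp p φ ξ) (hη : D.HeadsUp p (-φ) η) :
    D.cost p ξ η ≤ 4 * ε := by
  have hε0 : 0 ≤ ε := (abs_nonneg _).trans (hφ.2 p p (by simp) (by simp))
  by_contra! hcon
  have hcompl : {ξ | D.HeadsUp p φ ξ}ᶜ = {ξ | D.HeadsUp p (-φ) ξ} := by
    ext z
    exact ⟨fun h => (headsUp_or hφ hε z).resolve_left h,
      fun h h' => h'.not_headsUp_neg hφ hε h⟩
  have hclopen : IsClopen {ξ | D.HeadsUp p φ ξ} := by
    refine ⟨⟨?_⟩, isOpen_headsUp hφ hε⟩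
    rw [hcompl]
    exact isOpen_headsUp hφ.neg hε
  obtain ⟨q, hq, hle⟩ := hD.exists_detecting_point p hclopen
    (fun a ha b hb hab => HeadsUp.seven_le_cost hφ hε ha hb hab)
    (fun a ha b hb hab => by
      rw [hcompl] at ha hb
      exact HeadsUp.seven_le_cost hφ.neg hε ha hb hab)
    hξ (hcompl ▸ hη : η ∈ {ξ | D.HeadsUp p φ ξ}ᶜ) (by linarith)
  -- the value of the Busemann function is pinned down by the coordinate on both sides
  have upper : ∀ ψ : X → ℝ, IsAlmostCoordinate p ε ψ → ∀ z, D.HeadsUp p ψ z →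
      D.busemann z p q ≤ ψ q + 2 * ε := by
    intro ψ hψ z hz
    obtain ⟨w, hzw, hw⟩ := D.exists_antipode p z
    have hw' : D.HeadsUp p (-ψ) w := by
      refine (headsUp_or hψ hε w).resolve_left fun h => ?_
      have := hz.seven_le_cost hψ hε h hzw
      linarith
    have h1 := hw'.le_busemann hψ.neg hε hq
    have h2 := D.busemann_add_le_cost hzw p q
    rw [Pi.neg_apply] at h1
    linarith
  have h1 := upper φ hφ ξ hξ
  have h2 := upper (-φ) hφ.neg η hη
  rw [Pi.neg_apply] at h2
  have h3 : 4 * ε < min (D.cost p ξ η) 1 := lt_min hcon (by linarith)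
  linarith

end GromovProductData

namespace GromovProductData

variable {X : Type u} [MetricSpace X] {D : GromovProductData X}

section FarPoints

variable {y : X} {C : ℝ} (hC : ∀ ξ η, D.cost y ξ η ≤ C) {e : X → D.Boundary}
  (he : ∀ z, D.busemann (e z) y z = dist y z)
include hC he

lemma busemann_of_ne {z : X} (hz : C < dist y z) {η : D.Boundary} (h : e z ≠ η) :
    D.busemann η y z = -dist y z + D.cost y (e z) η := by
  have upper : ∀ η, e z ≠ η → D.busemann η y z ≤ -dist y z + D.cost y (e z) η := fun η h => by
    have := D.busemann_add_le_cost h y z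
    have := he z
    linarith
  refine le_antisymm (upper η h) ?_
  obtain ⟨ω, hω, hω0⟩ := D.exists_antipode z η
  rw [D.cost_change hω y z] at hω0
  by_cases h' : e z = ω
  · rw [← h', he z, D.cost_comm] at hω0
    linarith
  · linarith [upper η h, upper ω h', D.cost_nonneg y η ω, hC (e z) η, hC (e z) ω]

lemma dist_le_of_eq {z w : X} (hz : C < dist y z) (hw : C < dist y w) (h : e z = e w) :
    dist z w ≤ |dist y z - dist y w| := by
  obtain ⟨ω, hω⟩ := D.exists_busemann_eq_dist z w
  have h1 := D.busemann_add ω y z w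
  by_cases hzω : e z = ω
  · have h2 := he z
    have h3 := he w
    rw [← h] at h3
    rw [hzω] at h2 h3
    have := neg_abs_le (dist y z - dist y w)
    linarith
  · have h2 := busemann_of_ne hC he hz hzω
    have h3 := busemann_of_ne hC he hw (h ▸ hzω)
    rw [← h] at h3
    have := le_abs_self (dist y z - dist y w)
    linarith

lemma dist_eq_of_ne {z w : X} (hz : C < dist y z) (hw : C < dist y w) (h : e z ≠ e w) :
    dist z w = dist y z + dist y w - D.cost y (e z) (e w) := by
  have hzw := busemann_of_ne hC he hz h
  have hwz := busemann_of_ne hC he hw h.symm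
  rw [D.cost_comm] at hwz
  have hc := hC (e z) (e w)
  apply le_antisymm
  · obtain ⟨ω, hω⟩ := D.exists_busemann_eq_dist z w
    have h1 := D.busemann_add ω y z w
    by_cases hzω : e z = ω
    · rw [hzω] at hwz hc ⊢
      have h2 := D.neg_dist_le_busemann ω y z
      have h3 := he z
      rw [hzω] at h3
      linarith
    · have h2 := busemann_of_ne hC he hz hzω
      by_cases hwω : e w = ω
      · have h3 := he w
        rw [hwω] at h3 ⊢
        linarith
      · have h3 := busemann_of_ne hC he hw hwω
        linarith [hC (e w) ω, D.cost_nonneg y (e z) ω]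
  · have h1 := D.busemann_add (e w) y z w
    have h2 := D.busemann_le (e w) z w
    have h3 := he w
    linarith

lemma eq_of_busemann_eq {z : X} (hz : C < 2 * dist y z) {ζ : D.Boundary}
    (h : D.busemann ζ y z = dist y z) : e z = ζ := by
  by_contra hne
  have := D.busemann_add_le_cost hne y z
  linarith [he z, hC (e z) ζ]

end FarPoints

end GromovProductData

/-- In the annulus of radii `C + 1` and `R` about `x`, the space is, up to the error `3 * ε`, a
union of disjoint segments labelled by `g`, the offsets between the segments being given by `c`. -/
structure IsAlmostStar {X W : Type*} [MetricSpace X] (x : X) (g : X → W) (c : W → W → ℝ)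
    (C R ε : ℝ) : Prop where
  nonneg : ∀ i j, 0 ≤ c i j
  le : ∀ i j, c i j ≤ C
  dist_le : ∀ a b, C + 1 ≤ dist x a → dist x a ≤ R → C + 1 ≤ dist x b → dist x b ≤ R →
    g a = g b → dist a b ≤ |dist x a - dist x b| + 3 * ε
  abs_dist_le : ∀ a b, C + 1 ≤ dist x a → dist x a ≤ R → C + 1 ≤ dist x b → dist x b ≤ R →
    g a ≠ g b → |dist a b - (dist x a + dist x b - c (g a) (g b))| ≤ 3 * ε

namespace IsAlmostStar

section Coordinate

variable {X W : Type*} [MetricSpace X] {x : X} {g : X → W} {c : W → W → ℝ} {C R ε S : ℝ}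
  (H : IsAlmostStar x g c C R ε) (hS : C + 10 ≤ S) (hR : S + 5 ≤ R) (hε0 : 0 < ε)
  (hε : ε ≤ 1 / 100)
include H hS hR hε0 hε

lemma eq_of_dist_le {p : X} (hp : dist x p = S) {a : X} (ha : dist p a ≤ 4) : g a = g p := by
  by_contra hne
  have hC0 := (H.nonneg (g p) (g p)).trans (H.le _ _)
  have h1 := dist_triangle x p a
  have h2 := dist_triangle x a p
  rw [dist_comm a p] at h2
  have h3 := abs_le.1 (H.abs_dist_le a p (by linarith) (by linarith) (by linarith) (by linarith) hne)
  rw [dist_comm a p] at h3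
  have := H.le (g a) (g p)
  linarith

lemma isAlmostCoordinate {p : X} (hp : dist x p = S) :
    IsAlmostCoordinate p (3 * ε) (fun a => dist x a - S) := by
  have hC0 := (H.nonneg (g p) (g p)).trans (H.le _ _)
  refine ⟨by simp [hp], fun a b ha hb => ?_⟩
  have range : ∀ a, dist p a ≤ 4 → C + 1 ≤ dist x a ∧ dist x a ≤ R := fun a ha => by
    have h1 := dist_triangle x p a
    have h2 := dist_triangle x a p
    rw [dist_comm a p] at h2
    exact ⟨by linarith, by linarith⟩
  have h1 := H.dist_le a b (range a ha).1 (range a ha).2 (range b hb).1 (range b hb).2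
    ((H.eq_of_dist_le hS hR hε0 hε hp ha).trans (H.eq_of_dist_le hS hR hε0 hε hp hb).symm)
  have h2 := abs_dist_sub_le a b x
  rw [dist_comm a x, dist_comm b x] at h2
  rw [sub_sub_sub_cancel_right, abs_le]
  exact ⟨by linarith, by linarith⟩

end Coordinate

section Boundary

open GromovProductData

variable {X : Type u} [MetricSpace X] {D : GromovProductData X} {W : Type*} {x : X} {g : X → W}
  {c : W → W → ℝ} {C R ε S : ℝ}
  (H : IsAlmostStar x g c C R ε) (hS : C + 10 ≤ S) (hR : S + 5 ≤ R) (hε0 : 0 < ε)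
  (hε : ε ≤ 1 / 100)

lemma headsUp_of_busemann_eq {p : X} {ξ : D.Boundary} (hξ : D.busemann ξ x p = S) :
    D.HeadsUp p (fun a => dist x a - S) ξ := by
  obtain ⟨r, hr, hr'⟩ := D.exists_dist_eq_busemann_eq p ξ (s := 4) (by norm_num)
  refine ⟨r, hr, hr', ?_⟩
  have h1 := D.busemann_add ξ x p r
  have h2 := D.busemann_le ξ x r
  show 0 < dist x r - S
  linarith

include H hS hR hε0 hε

lemma headsUp_neg_of_busemann_eq_dist {p : X} (hp : dist x p = S) {r : X} (hr : C + 1 ≤ dist x r)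
    (hr' : dist x r ≤ R) (hne : g r ≠ g p) {ω : D.Boundary} (hω : D.busemann ω p r = dist p r) :
    D.HeadsUp p (-fun a => dist x a - S) ω := by
  have hC0 := (H.nonneg (g p) (g p)).trans (H.le _ _)
  have hφ := H.isAlmostCoordinate hS hR hε0 hε hp
  have h1 := abs_le.1 (H.abs_dist_le p r (by linarith) (by linarith) hr hr' hne.symm)
  have hle := H.le (g p) (g r)
  obtain ⟨s, hs, hs'⟩ := D.geodesic.exists_dist_eq_of_le p r (s := 4) (by norm_num) (by linarith)
  have h2 := D.busemann_add ω p s r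
  have h3 := D.busemann_le ω s r
  have h4 := D.busemann_le ω p s
  refine ⟨s, hs, by linarith, ?_⟩
  show 0 < -(dist x s - S)
  by_contra! hcon
  have h5 := abs_le.1 (hφ.2 p s (by simp) hs.le)
  beta_reduce at h5
  rw [hp, sub_self, zero_sub, abs_neg, abs_of_nonneg (by linarith), hs] at h5
  have hgs := H.eq_of_dist_le hS hR hε0 hε hp hs.le
  have h6 := dist_triangle x p s
  have h7 := abs_le.1 (H.abs_dist_le s r (by linarith) (by linarith) hr hr' (hgs ▸ hne.symm))
  rw [hgs] at h7
  linarith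

/-- A ray going out along one branch has the points of all other branches behind it. -/
lemma busemann_le_of_ne (hD : D.IsMaximal) {p : X} (hp : dist x p = S) {η : D.Boundary}
    (hη : D.busemann η x p = S) {r : X} (hr : C + 1 ≤ dist x r) (hr' : dist x r ≤ R)
    (hne : g r ≠ g p) : D.busemann η p r ≤ -dist p r + 12 * ε := by
  have hφ := H.isAlmostCoordinate hS hR hε0 hε hp
  obtain ⟨ω, hω⟩ := D.exists_busemann_eq_dist p r
  have h1 := H.headsUp_neg_of_busemann_eq_dist hS hR hε0 hε hp hr hr' hne hω
  have h2 := headsUp_of_busemann_eq hη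
  have hηω : η ≠ ω := by
    rintro rfl
    exact h2.not_headsUp_neg hφ (by linarith) h1
  have h3 := hD.cost_le hφ (by linarith) h2 h1
  have h4 := D.busemann_add_le_cost hηω p r
  linarith

lemma eq_of_busemann_eq_dist (hD : D.IsMaximal) {p : X} (hp : dist x p = S) {η : D.Boundary}
    (hη : D.busemann η x p = S) {r : X} (hr : S - 1 ≤ dist x r) (hr' : dist x r ≤ R)
    (h : D.busemann η x r = dist x r) : g r = g p := by
  by_contra hne
  have hC0 := (H.nonneg (g p) (g p)).trans (H.le _ _)
  have h1 := H.busemann_le_of_ne hS hR hε0 hε hD hp hη (by linarith) hr' hne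
  have h2 := abs_le.1 (H.abs_dist_le p r (by linarith) (by linarith) (by linarith) hr' (Ne.symm hne))
  have h3 := D.busemann_add η x p r
  have := H.le (g p) (g r)
  linarith

lemma headsUp_neg_of_ne (hD : D.IsMaximal) {p p' : X} (hp : dist x p = S) (hp' : dist x p' = S)
    (hne : g p ≠ g p') {η : D.Boundary} (hη : D.busemann η x p' = S) :
    D.HeadsUp p (-fun a => dist x a - S) η := by
  have hC0 := (H.nonneg (g p) (g p)).trans (H.le _ _)
  have hφ := H.isAlmostCoordinate hS hR hε0 hε hp
  refine (headsUp_or hφ (by linarith) η).resolve_left ?_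
  rintro ⟨r, hr, hr', hr0⟩
  have h1 := abs_le.1 (abs_sub_four_le hφ hr hr0)
  have hgr := H.eq_of_dist_le hS hR hε0 hε hp hr.le
  have h2 := dist_triangle x p r
  have h3 := abs_le.1 (H.abs_dist_le p' r (by linarith) (by linarith) (by linarith) (by linarith)
    (hgr ▸ hne.symm))
  have h4 := abs_le.1 (H.abs_dist_le p' p (by linarith) (by linarith) (by linarith) (by linarith)
    hne.symm)
  have h5 := H.busemann_le_of_ne hS hR hε0 hε hD hp' hη (by linarith) (by linarith)
    (hgr ▸ hne : g r ≠ g p')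
  have h6 := D.busemann_add η p' p r
  have h7 := D.neg_dist_le_busemann η p' p
  rw [hgr] at h3
  linarith

lemma abs_cost_sub_le (hD : D.IsMaximal) {p p' : X} (hp : dist x p = S) (hp' : dist x p' = S)
    (hne : g p ≠ g p') {ξ η : D.Boundary} (hξ : D.busemann ξ x p = S)
    (hη : D.busemann η x p' = S) (hξη : ξ ≠ η) :
    |c (g p) (g p') - D.cost x ξ η| ≤ 30 * ε := by
  have hC0 := (H.nonneg (g p) (g p)).trans (H.le _ _)
  have hφ := H.isAlmostCoordinate hS hR hε0 hε hp
  have h1 := D.busemann_add_sub_le_cost hξη x p p'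
  have h2 := abs_le.1 (H.abs_dist_le p p' (by linarith) (by linarith) (by linarith) (by linarith)
    hne)
  have h3 := hD.cost_le hφ (by linarith) (headsUp_of_busemann_eq hξ)
    (H.headsUp_neg_of_ne hS hR hε0 hε hD hp hp' hne hη)
  have h4 := H.busemann_le_of_ne hS hR hε0 hε hD hp' hη (r := p) (by linarith) (by linarith) hne
  have h5 := D.cost_change hξη x p
  have h6 := D.busemann_add η x p' p
  rw [dist_comm p' p] at h4
  rw [abs_le]
  exact ⟨by linarith, by linarith⟩

lemma le_cost_of_eq {p p' : X} (hp : dist x p = S) (hp' : dist x p' = S)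
    (heq : g p = g p') {ξ η : D.Boundary} (hξ : D.busemann ξ x p = S)
    (hη : D.busemann η x p' = S) (hξη : ξ ≠ η) : 2 * S - 3 * ε ≤ D.cost x ξ η := by
  have hC0 := (H.nonneg (g p) (g p)).trans (H.le _ _)
  have h1 := D.busemann_add_sub_le_cost hξη x p p'
  have h2 := H.dist_le p p' (by linarith) (by linarith) (by linarith) (by linarith) heq
  rw [hp, hp', sub_self, abs_zero] at h2
  linarith

end Boundary

end IsAlmostStar

namespace GromovProductData

variable {X : Type u} [MetricSpace X] {D : GromovProductData X}

lemma isAlmostStar {Z : Type*} [MetricSpace Z] {x : Z} {y : X} {C : ℝ}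
    (hC : ∀ ξ η, D.cost y ξ η ≤ C) {e : X → D.Boundary}
    (he : ∀ z, D.busemann (e z) y z = dist y z) {F : Z → X} {R ε : ℝ} (hR : 0 ≤ R) (hε : ε ≤ 1)
    (hx : F x = y)
    (hF : ∀ a b, dist x a ≤ R → dist x b ≤ R → |dist (F a) (F b) - dist a b| < ε) :
    IsAlmostStar x (fun a => e (F a)) (D.cost y) C R ε := by
  have near : ∀ a, dist x a ≤ R → |dist y (F a) - dist x a| < ε := fun a ha => by
    simpa [hx] using hF x a (by simpa using hR) ha
  have far : ∀ a, C + 1 ≤ dist x a → dist x a ≤ R → C < dist y (F a) := fun a ha ha' => by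
    linarith [abs_lt.1 (near a ha')]
  refine ⟨D.cost_nonneg y, hC, fun a b ha ha' hb hb' h => ?_, fun a b ha ha' hb hb' h => ?_⟩
  · have h1 := dist_le_of_eq hC he (far a ha ha') (far b hb hb') h
    have h2 := abs_lt.1 (near a ha')
    have h3 := abs_lt.1 (near b hb')
    have h4 := abs_lt.1 (hF a b ha' hb')
    have h5 : |dist y (F a) - dist y (F b)| ≤ |dist x a - dist x b| + 2 * ε := by
      have h6 := le_abs_self (dist x a - dist x b)
      have h7 := neg_abs_le (dist x a - dist x b)
      exact abs_le.2 ⟨by linarith, by linarith⟩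
    linarith
  · have h1 := dist_eq_of_ne hC he (far a ha ha') (far b hb hb') h
    have h2 := abs_lt.1 (near a ha')
    have h3 := abs_lt.1 (near b hb')
    have h4 := abs_lt.1 (hF a b ha' hb')
    exact abs_le.2 ⟨by linarith, by linarith⟩

end GromovProductData

lemma PointedGHConverges.exists_map {X : ℕ → Type u} [∀ n, MetricSpace (X n)] {x : ∀ n, X n}
    {Y : Type v} [MetricSpace Y] {y : Y} (h : PointedGHConverges X x Y y) {R ε : ℝ} (hR : 0 < R)
    (hε : 0 < ε) :
    ∀ᶠ n in atTop, ∃ F : X n → Y, F (x n) = y ∧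
      (∀ a b, dist (x n) a ≤ R → dist (x n) b ≤ R → |dist (F a) (F b) - dist a b| < ε) ∧
      ∀ z, dist y z ≤ R → ∃ a, dist (x n) a ≤ R ∧ dist (F a) z < ε := by
  obtain ⟨N, hN⟩ := h R hR ε hε
  filter_upwards [eventually_ge_atTop N] with n hn
  obtain ⟨f, hf, hdist, hnet⟩ := hN n hn
  classical
  let F : X n → Y := fun a => if h : a ∈ closedBall (x n) R then f ⟨a, h⟩ else y
  have F_eq : ∀ a (ha : dist (x n) a ≤ R), F a = f ⟨a, mem_closedBall'.2 ha⟩ := fun a ha =>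
    dif_pos (mem_closedBall'.2 ha)
  refine ⟨F, ?_, fun a b ha hb => ?_, fun z hz => ?_⟩
  · rw [F_eq _ (by simpa using hR.le), hf]
  · rw [F_eq a ha, F_eq b hb]
    exact hdist _ _
  · obtain ⟨a, ha⟩ := hnet ⟨z, mem_closedBall'.2 hz⟩
    refine ⟨a, mem_closedBall'.1 a.2, ?_⟩
    rw [F_eq _ (mem_closedBall'.1 a.2)]
    exact ha

lemma abs_exp_neg_sub_exp_neg_le {s t : ℝ} (hs : 0 ≤ s) (ht : 0 ≤ t) :
    |Real.exp (-s) - Real.exp (-t)| ≤ |s - t| := by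
  have key : ∀ {s t : ℝ}, 0 ≤ s → 0 ≤ t → Real.exp (-s) - Real.exp (-t) ≤ |s - t| :=
    fun {s t} hs ht => by
      have h1 := Real.add_one_le_exp (s - t)
      have h2 : Real.exp (-t) = Real.exp (-s) * Real.exp (s - t) := by
        rw [← Real.exp_add]
        ring_nf
      have h3 : Real.exp (-s) ≤ 1 := Real.exp_le_one_iff.2 (by linarith)
      have h4 := Real.exp_pos (-s)
      have h5 := neg_abs_le (s - t)
      have h6 := abs_nonneg (s - t)
      nlinarith
  rw [abs_le]
  have := key ht hs
  rw [abs_sub_comm] at this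
  exact ⟨by linarith, key hs ht⟩

namespace GromovProductData

variable {X : Type u} [MetricSpace X] {D : GromovProductData X}

/-- A Gromov product space that is sufficiently close, on a large ball, to a maximal one with
finitely many boundary points has an almost isometric boundary. -/
lemma exists_isEpsIsometry {Y : Type v} [MetricSpace Y] {DY : GromovProductData Y} {y : Y} {C : ℝ}
    (hC : ∀ ξ η, DY.cost y ξ η ≤ C) (hD : D.IsMaximal) {x : X} {F : X → Y} {R S ε δ : ℝ}
    (hS : C + 10 ≤ S) (hR : S + 5 ≤ R) (hε0 : 0 < ε) (hε : ε ≤ 1 / 100) (hεδ : 30 * ε ≤ δ)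
    (hSδ : Real.exp (-(S - 1)) < δ) (hx : F x = y)
    (hF : ∀ a b, dist x a ≤ R → dist x b ≤ R → |dist (F a) (F b) - dist a b| < ε)
    (hnet : ∀ z, dist y z ≤ R → ∃ a, dist x a ≤ R ∧ dist (F a) z < ε) :
    ∃ f : D.Boundary → DY.Boundary, IsEpsIsometry (D.visual x) (DY.visual y) δ f := by
  choose e he using fun z => DY.exists_busemann_eq_dist y z
  have hC0 : 0 ≤ C := (DY.cost_nonneg y (e y) (e y)).trans (hC _ _)
  have H := isAlmostStar hC he (by linarith) (by linarith) hx hF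
  choose p hp hpξ using fun ξ => D.exists_dist_eq_busemann_eq x ξ (s := S) (by linarith)
  refine ⟨fun ξ => e (F (p ξ)), fun ξ η => ?_, fun ζ => ?_⟩
  · rcases eq_or_ne ξ η with rfl | hξη
    · rw [visual_self, visual_self, sub_zero, abs_zero]
      linarith
    rw [D.visual_of_ne x hξη]
    beta_reduce
    by_cases h : e (F (p ξ)) = e (F (p η))
    · have h1 := H.le_cost_of_eq hS hR hε0 hε (hp ξ) (hp η) h (hpξ ξ) (hpξ η) hξη
      rw [h, visual_self, zero_sub, abs_neg, Real.abs_exp]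
      exact (Real.exp_le_exp.2 (by linarith)).trans_lt hSδ
    · have h1 := H.abs_cost_sub_le hS hR hε0 hε hD (hp ξ) (hp η) h (hpξ ξ) (hpξ η) hξη
      rw [DY.visual_of_ne y h]
      refine (abs_exp_neg_sub_exp_neg_le (by linarith [DY.cost_nonneg y (e (F (p ξ))) (e (F (p η)))])
        (by linarith [D.cost_nonneg x ξ η])).trans_lt ?_
      rw [← sub_div, abs_div, abs_two]
      linarith
  · obtain ⟨z, hz, hzζ⟩ := DY.exists_dist_eq_busemann_eq y ζ (s := S) (by linarith)
    obtain rfl := eq_of_busemann_eq hC he (by linarith) (hzζ.trans hz.symm)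
    obtain ⟨a, ha, haz⟩ := hnet z (by linarith)
    have h1 : |dist y (F a) - dist x a| < ε := by
      simpa [hx] using hF x a (by simpa using (by linarith : 0 ≤ R)) ha
    have h2 := dist_triangle y (F a) z
    have h3 := abs_lt.1 h1
    have haz' : e (F a) = e z := by
      by_contra hne
      have := dist_eq_of_ne hC he (by linarith) (by linarith) hne
      linarith [hC (e (F a)) (e z)]
    obtain ⟨ξ, hξ⟩ := D.exists_busemann_eq_dist x a
    have h4 := H.eq_of_busemann_eq_dist hS hR hε0 hε hD (hp ξ) (hpξ ξ) (by linarith) ha hξ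
    refine ⟨ξ, ?_⟩
    rw [← haz', h4, visual_self]
    linarith

end GromovProductData

lemma IsEpsIsometry.mono {Z₁ Z₂ : Type*} {ρ₁ : Z₁ → Z₁ → ℝ} {ρ₂ : Z₂ → Z₂ → ℝ} {ε ε' : ℝ}
    {f : Z₁ → Z₂} (h : IsEpsIsometry ρ₁ ρ₂ ε f) (hε : ε ≤ ε') : IsEpsIsometry ρ₁ ρ₂ ε' f :=
  ⟨fun ξ η => (h.1 ξ η).trans_le hε, fun ζ => (h.2 ζ).imp fun _ hξ => hξ.trans_le hε⟩

lemma AIConverges.of_eventually {Z : ℕ → Type u} {ρ : ∀ n, Z n → Z n → ℝ} {W : Type v}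
    {ρ₀ : W → W → ℝ} {K : ℝ} (hK : ∀ n, ∃ f : Z n → W, IsEpsIsometry (ρ n) ρ₀ K f)
    (h : ∀ δ > 0, ∀ᶠ n in atTop, ∃ f : Z n → W, IsEpsIsometry (ρ n) ρ₀ δ f) :
    AIConverges ρ ρ₀ := by
  let A : ℕ → Set ℝ := fun n => {ε | 0 ≤ ε ∧ ∃ f : Z n → W, IsEpsIsometry (ρ n) ρ₀ ε f}
  have bdd : ∀ n, BddBelow (A n) := fun n => ⟨0, fun ε hε => hε.1⟩
  have ne : ∀ n, (A n).Nonempty := fun n => by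
    obtain ⟨f, hf⟩ := hK n
    exact ⟨max K 0, le_max_right _ _, f, hf.mono (le_max_left _ _)⟩
  have nonneg : ∀ n, 0 ≤ sInf (A n) := fun n => Real.sInf_nonneg fun ε hε => hε.1
  have pos : ∀ n : ℕ, (0 : ℝ) < 1 / (n + 1) := fun n => Nat.one_div_pos_of_nat
  refine ⟨fun n => sInf (A n) + 1 / (n + 1), fun n => add_pos_of_nonneg_of_pos (nonneg n) (pos n),
    ?_, fun n => ?_⟩
  · suffices Tendsto (fun n => sInf (A n)) atTop (𝓝 0) by
      simpa using this.add tendsto_one_div_add_atTop_nhds_zero_nat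
    refine Metric.tendsto_nhds.2 fun δ hδ => ?_
    filter_upwards [h (δ / 2) (half_pos hδ)] with n hn
    rw [Real.dist_0_eq_abs, abs_of_nonneg (nonneg n)]
    exact (csInf_le (bdd n) ⟨(half_pos hδ).le, hn⟩).trans_lt (half_lt_self hδ)
  · obtain ⟨ε, ⟨-, f, hf⟩, hε⟩ := exists_lt_of_csInf_lt (ne n) (lt_add_of_pos_right _ (pos n))
    exact ⟨f, hf.mono hε.le⟩

/-- If maximal Gromov product spaces `(X n, x n)` converge in the pointed
Gromov–Hausdorff sense to a maximal Gromov product space `(Y, y)` with finite Gromov product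
boundary, then the boundaries `(∂_P X n, ρ_{x n})` AI-converge to `(∂_P Y, ρ_y)`. -/
theorem boundaries_AI_converge_of_GH_converges_to_finite_boundary
    {X : ℕ → Type u} [∀ n, MetricSpace (X n)] (D : ∀ n, GromovProductData (X n))
    (hmax : ∀ n, (D n).IsMaximal) (x : ∀ n, X n)
    {Y : Type u} [MetricSpace Y] (DY : GromovProductData Y) (hmaxY : DY.IsMaximal)
    (hfin : Finite DY.Boundary) (y : Y)
    (hGH : PointedGHConverges X x Y y) :
    AIConverges (fun n => (D n).visual (x n)) (DY.visual y) := by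
  have ne : ∀ n, Nonempty (D n).Boundary := fun n =>
    ⟨((D n).exists_busemann_eq_dist (x n) (x n)).choose⟩
  have neY : Nonempty DY.Boundary := ⟨(DY.exists_busemann_eq_dist y y).choose⟩
  obtain ⟨ξη, hξη⟩ := Finite.exists_max fun ξη : DY.Boundary × DY.Boundary => DY.cost y ξη.1 ξη.2
  set C := DY.cost y ξη.1 ξη.2
  have hC : ∀ ξ η, DY.cost y ξ η ≤ C := fun ξ η => hξη (ξ, η)
  have hC0 : 0 ≤ C := DY.cost_nonneg y _ _
  refine AIConverges.of_eventually (K := 2) (fun n => ?_) fun δ hδ => ?_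
  · refine ⟨fun _ => Classical.arbitrary _, fun ξ η => abs_lt.2 ⟨?_, ?_⟩,
      fun ζ => ⟨Classical.arbitrary _, ?_⟩⟩
    · linarith [(D n).visual_le_one (x n) ξ η, DY.visual_nonneg y (Classical.arbitrary _)
        (Classical.arbitrary _)]
    · linarith [(D n).visual_nonneg (x n) ξ η, DY.visual_le_one y (Classical.arbitrary _)
        (Classical.arbitrary _)]
    · linarith [DY.visual_le_one y (Classical.arbitrary _) ζ]
  · have hδ' : 0 < δ⁻¹ := inv_pos.2 hδ
    have hε0 : 0 < min (1 / 100) (δ / 30) := by positivity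
    filter_upwards [hGH.exists_map (R := C + 10 + δ⁻¹ + 5) (by linarith) hε0]
      with n ⟨F, hx, hF, hnet⟩
    refine GromovProductData.exists_isEpsIsometry hC (hmax n) (S := C + 10 + δ⁻¹) (by linarith)
      le_rfl hε0 (min_le_left _ _) (by linarith [min_le_right (1 / 100) (δ / 30)]) ?_ hx hF hnet
    have h1 := Real.add_one_le_exp (C + 10 + δ⁻¹ - 1)
    rw [Real.exp_neg, inv_lt_comm₀ (Real.exp_pos _) hδ]
    linarith
end
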